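/- arXiv:1608.02987 — 2 statements merged into one kernel-verified Lean document; each statement's English description precedes it below -/
import Mathlib

section
/- Let d = 4. There exists c_0 ∈ ℝ such that if |x|, |y|, |x−y| ≤ N/2, then G_N²(x,y) = (8/π²) log(N/|x−y|) + c_0 + O((|x| + |y| + 1)/N + 1/|x−y|). -/
open MeasureTheory Filter Topology
open scoped Classical

namespace GreenFn

noncomputable def nrm {d : ℕ} (x : Fin d → ℤ) : ℝ :=
  Real.sqrt (∑ i, ((x i : ℝ)) ^ 2)

/-- the `2d` unit lattice vectors in `ℤ^d` -/
def steps (d : ℕ) : Finset (Fin d → ℤ) :=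
  (Finset.univ : Finset (Fin d × Bool)).image
    (fun p => fun i => if i = p.1 then (if p.2 then 1 else -1) else 0)

/-- `j`-step transition probability of simple random walk on `ℤ^d` -/
noncomputable def trans (d : ℕ) : ℕ → (Fin d → ℤ) → (Fin d → ℤ) → ℝ
  | 0 => fun x y => if x = y then 1 else 0
  | (j + 1) => fun x y => (2 * (d : ℝ))⁻¹ * ∑ e ∈ steps d, trans d j (x + e) y

/-- Green's function of simple random walk on `ℤ^d`: expected number of visits
to `y` starting from `x`. -/
noncomputable def G (d : ℕ) (x y : Fin d → ℤ) : ℝ := ∑' j : ℕ, trans d j x y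

/-- `G²(x,y) = Σ_z G(x,z) G(z,y)` -/
noncomputable def G2 (d : ℕ) (x y : Fin d → ℤ) : ℝ :=
  ∑' z : Fin d → ℤ, G d x z * G d z y

/-- `j`-step transition probability of simple random walk on `ℤ^d` killed upon
exiting `A_N = {x : |x| ≤ N}`. -/
noncomputable def transK (d : ℕ) (N : ℝ) : ℕ → (Fin d → ℤ) → (Fin d → ℤ) → ℝ
  | 0 => fun x y => if x = y ∧ nrm x ≤ N then 1 else 0
  | (j + 1) => fun x y =>
      if nrm x ≤ N then (2 * (d : ℝ))⁻¹ * ∑ e ∈ steps d, transK d N j (x + e) y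
      else 0

/-- Green's function of simple random walk on `A_N`, killed upon exiting. -/
noncomputable def GN (d : ℕ) (N : ℝ) (x y : Fin d → ℤ) : ℝ :=
  ∑' j : ℕ, transK d N j x y

/-- `G_N²(x,y) = Σ_{z ∈ A_N} G_N(x,z) G_N(z,y)` -/
noncomputable def GN2 (d : ℕ) (N : ℝ) (x y : Fin d → ℤ) : ℝ :=
  ∑' z : Fin d → ℤ, GN d N x z * GN d N z y

/-- Transition probability at time `t` of the rate one continuous-time simple random walk on `ℤ`,
given by its Fourier representation. -/
noncomputable def heat1 (t : ℝ) (k : ℤ) : ℝ :=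
  (2 * Real.pi)⁻¹ * ∫ θ in (-Real.pi)..Real.pi,
    Real.exp (-t * (1 - Real.cos θ)) * Real.cos (k * θ)

lemma heat1_neg (t : ℝ) (k : ℤ) : heat1 t (-k) = heat1 t k := by
  simp [heat1]

lemma heat1_zero (k : ℤ) : heat1 0 k = if k = 0 then 1 else 0 := by
  unfold heat1
  split_ifs with h
  · subst h
    have := Real.pi_pos
    simp
    field_simp
    norm_num
  · have hk : (k : ℝ) ≠ 0 := by exact_mod_cast h
    simp only [neg_zero, zero_mul, Real.exp_zero, one_mul]
    rw [intervalIntegral.integral_comp_mul_left (fun x => Real.cos x) hk]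
    simp [Real.sin_int_mul_pi]

lemma abs_heat1_le_one {t : ℝ} (ht : 0 ≤ t) (k : ℤ) : |heat1 t k| ≤ 1 := by
  have hpi := Real.pi_pos
  have h : ‖∫ θ in (-Real.pi)..Real.pi,
      Real.exp (-t * (1 - Real.cos θ)) * Real.cos (k * θ)‖ ≤ 1 * |Real.pi - -Real.pi| := by
    apply intervalIntegral.norm_integral_le_of_norm_le_const
    intro θ _
    rw [norm_mul, Real.norm_eq_abs, Real.norm_eq_abs, Real.abs_exp]
    refine mul_le_one₀ ?_ (abs_nonneg _) (Real.abs_cos_le_one _)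
    rw [Real.exp_le_one_iff]
    nlinarith [Real.cos_le_one θ]
  rw [Real.norm_eq_abs, abs_of_pos (by linarith : 0 < Real.pi - -Real.pi)] at h
  rw [heat1, abs_mul, abs_of_pos (by positivity)]
  calc _ ≤ (2 * Real.pi)⁻¹ * (1 * (Real.pi - -Real.pi)) := by gcongr
    _ = 1 := by field_simp; ring

lemma hasDerivAt_heat1 (t : ℝ) (k : ℤ) :
    HasDerivAt (fun s => heat1 s k)
      ((heat1 t (k + 1) + heat1 t (k - 1)) / 2 - heat1 t k) t := by
  have key := (intervalIntegral.hasDerivAt_integral_of_dominated_loc_of_deriv_le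
    (μ := volume) (a := -Real.pi) (b := Real.pi) (x₀ := t) (s := Metric.ball t 1)
    (F := fun s θ => Real.exp (-s * (1 - Real.cos θ)) * Real.cos (k * θ))
    (F' := fun s θ => -(1 - Real.cos θ) * Real.exp (-s * (1 - Real.cos θ)) * Real.cos (k * θ))
    (bound := fun _ => 2 * Real.exp ((|t| + 1) * 2))
    (Metric.ball_mem_nhds t one_pos) ?_ ?_ ?_ ?_ ?_ ?_).2
  · have h2 := key.const_mul (2 * Real.pi)⁻¹
    refine HasDerivAt.congr_deriv (f := fun s => heat1 s k) h2 ?_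
    unfold heat1
    rw [← mul_add, ← intervalIntegral.integral_add, mul_div_assoc, ← intervalIntegral.integral_div,
      ← mul_sub, ← intervalIntegral.integral_sub]
    · congr 1
      apply intervalIntegral.integral_congr
      intro θ _
      have h1 : ((k + 1 : ℤ) : ℝ) * θ = k * θ + θ := by push_cast; ring
      have h3 : ((k - 1 : ℤ) : ℝ) * θ = k * θ - θ := by push_cast; ring
      simp only [h1, h3, Real.cos_add, Real.cos_sub]
      ring
    all_goals
      apply Continuous.intervalIntegrable
      fun_prop
  · exact Eventually.of_forall fun s => by
      apply Continuous.aestronglyMeasurable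
      fun_prop
  · apply Continuous.intervalIntegrable
    fun_prop
  · apply Continuous.aestronglyMeasurable
    fun_prop
  · refine Eventually.of_forall fun θ _ s hs => ?_
    have hc1 := Real.cos_le_one θ
    have hc2 := Real.neg_one_le_cos θ
    have hs' : |s| ≤ |t| + 1 := by
      have h1 : |s - t| < 1 := by simpa [Real.dist_eq] using hs
      have h2 := abs_sub_abs_le_abs_sub s t
      linarith
    rw [norm_mul, norm_mul, Real.norm_eq_abs, Real.norm_eq_abs, Real.norm_eq_abs, Real.abs_exp]
    have e1 : |-(1 - Real.cos θ)| ≤ 2 := by rw [abs_le]; constructor <;> linarith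
    have e2 : Real.exp (-s * (1 - Real.cos θ)) ≤ Real.exp ((|t| + 1) * 2) := by
      apply Real.exp_le_exp.2
      have := neg_abs_le s
      have h5 := abs_nonneg s
      nlinarith
    calc _ ≤ 2 * Real.exp ((|t| + 1) * 2) * 1 := by
          gcongr
          exact Real.abs_cos_le_one _
      _ = _ := by ring
  · exact intervalIntegrable_const
  · refine Eventually.of_forall fun θ _ s _ => ?_
    have h : HasDerivAt (fun s : ℝ => -s * (1 - Real.cos θ)) (-(1 - Real.cos θ)) s := by
      simpa using ((hasDerivAt_id s).neg.mul_const (1 - Real.cos θ))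
    have := (h.exp).mul_const (Real.cos (k * θ))
    exact this.congr_deriv (by ring)

lemma heat1_exp_bound {t lam : ℝ} (ht : 0 ≤ t) (k : ℤ) :
    |heat1 t k| ≤ Real.exp (t * (Real.cosh lam - 1) - lam * k) := by
  have hpi := Real.pi_pos
  set F : ℂ → ℂ := fun z =>
    Complex.exp (-t * (1 - Complex.cos z)) * Complex.exp (Complex.I * k * z) with hF
  have hdiff : Differentiable ℂ F := by
    apply Differentiable.mul
    · apply Differentiable.cexp
      exact (differentiable_const _).mul ((differentiable_const _).sub Complex.differentiable_cos)
    · fun_prop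
  have hper : ∀ z, F (z + 2 * Real.pi) = F z := by
    intro z
    simp only [hF]
    rw [Complex.cos_add_two_pi]
    congr 1
    rw [Complex.exp_eq_exp_iff_exists_int]
    exact ⟨k, by ring⟩
  have hrect := Complex.integral_boundary_rect_eq_zero_of_differentiableOn F
    (⟨-Real.pi, 0⟩) (⟨Real.pi, lam⟩) hdiff.differentiableOn
  simp only at hrect
  have hside : ∀ y : ℝ, F ((Real.pi : ℝ) + y * Complex.I) = F ((-Real.pi : ℝ) + y * Complex.I) := by
    intro y
    rw [← hper ((-Real.pi : ℝ) + y * Complex.I)]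
    congr 1
    push_cast
    ring
  simp only [hside] at hrect
  have heq : (∫ x : ℝ in (-Real.pi)..Real.pi, F x) =
      ∫ x : ℝ in (-Real.pi)..Real.pi, F (x + lam * Complex.I) := by
    have : (∫ x : ℝ in (-Real.pi)..Real.pi, F x) -
        ∫ x : ℝ in (-Real.pi)..Real.pi, F (x + lam * Complex.I) = 0 := by
      simpa using hrect
    exact sub_eq_zero.1 this
  have hre : (∫ x : ℝ in (-Real.pi)..Real.pi, F x).re =
      ∫ θ in (-Real.pi)..Real.pi, Real.exp (-t * (1 - Real.cos θ)) * Real.cos (k * θ) := by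
    have hFi : IntervalIntegrable (fun x : ℝ => F x) volume (-Real.pi) Real.pi :=
      (hdiff.continuous.comp Complex.continuous_ofReal).intervalIntegrable _ _
    have := Complex.reCLM.intervalIntegral_comp_comm hFi
    simp only [Complex.reCLM_apply] at this
    rw [← this]
    apply intervalIntegral.integral_congr
    intro x _
    simp only [hF]
    have h1 : Complex.exp (-t * (1 - Complex.cos x)) =
        ((Real.exp (-t * (1 - Real.cos x)) : ℝ) : ℂ) := by push_cast; rfl
    have h2 : Complex.I * k * x = ((k * x : ℝ) : ℂ) * Complex.I := by push_cast; ring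
    rw [h1, Complex.re_ofReal_mul, h2, Complex.exp_ofReal_mul_I_re]
  have hnorm : ‖∫ x : ℝ in (-Real.pi)..Real.pi, F (x + lam * Complex.I)‖ ≤
      Real.exp (t * (Real.cosh lam - 1) - lam * k) * |Real.pi - -Real.pi| := by
    apply intervalIntegral.norm_integral_le_of_norm_le_const
    intro x _
    simp only [hF]
    rw [← Complex.exp_add, Complex.norm_exp]
    apply Real.exp_le_exp.2
    have hc : (Complex.cos (x + lam * Complex.I)).re = Real.cos x * Real.cosh lam := by
      rw [Complex.cos_add_mul_I]
      simp [← Complex.ofReal_cos, ← Complex.ofReal_sin, ← Complex.ofReal_cosh,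
        ← Complex.ofReal_sinh]
    have hl : (-(t : ℂ) * (1 - Complex.cos (x + lam * Complex.I)) +
        Complex.I * k * (x + lam * Complex.I)).re =
        -t * (1 - (Complex.cos (x + lam * Complex.I)).re) - lam * k := by
      simp
      ring
    rw [hl, hc]
    have h1 : Real.cos x * Real.cosh lam ≤ Real.cosh lam := by
      nlinarith [Real.cos_le_one x, Real.cosh_pos lam]
    nlinarith
  rw [← heq] at hnorm
  have h3 := (Complex.abs_re_le_norm _).trans hnorm
  rw [hre, abs_of_pos (by linarith : 0 < Real.pi - -Real.pi)] at h3
  rw [heat1, abs_mul, abs_of_pos (by positivity)]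
  calc _ ≤ (2 * Real.pi)⁻¹ *
        (Real.exp (t * (Real.cosh lam - 1) - lam * k) * (Real.pi - -Real.pi)) := by gcongr
    _ = _ := by field_simp; ring

lemma abs_heat1_le_exp {t lam : ℝ} (ht : 0 ≤ t) (k : ℤ) :
    |heat1 t k| ≤ Real.exp (t * (Real.cosh lam - 1) - lam * |(k : ℝ)|) := by
  rcases le_total 0 k with hk | hk
  · rw [abs_of_nonneg (by exact_mod_cast hk : (0 : ℝ) ≤ k)]
    exact heat1_exp_bound ht k
  · rw [abs_of_nonpos (by exact_mod_cast hk : (k : ℝ) ≤ 0), ← heat1_neg]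
    exact_mod_cast heat1_exp_bound ht (-k)

/-- The centred Gaussian density of variance `t`, evaluated at an integer. -/
noncomputable def gauss1 (t : ℝ) (k : ℤ) : ℝ :=
  (Real.sqrt (2 * Real.pi * t))⁻¹ * Real.exp (-(k : ℝ) ^ 2 / (2 * t))

lemma integrable_gauss_mul_cos {t : ℝ} (ht : 0 < t) (k : ℤ) :
    Integrable fun θ : ℝ => Real.exp (-(t / 2) * θ ^ 2) * Real.cos (k * θ) := by
  refine (integrable_exp_neg_mul_sq (half_pos ht)).mono' (by
    apply Continuous.aestronglyMeasurable; fun_prop) (Eventually.of_forall fun θ => ?_)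
  rw [norm_mul, Real.norm_eq_abs, Real.abs_exp]
  exact mul_le_of_le_one_right (Real.exp_pos _).le (Real.abs_cos_le_one _)

lemma gauss1_eq_integral {t : ℝ} (ht : 0 < t) (k : ℤ) :
    gauss1 t k = (2 * Real.pi)⁻¹ *
      ∫ θ : ℝ, Real.exp (-(t / 2) * θ ^ 2) * Real.cos (k * θ) := by
  have hpi := Real.pi_pos
  have hb : 0 < ((t / 2 : ℝ) : ℂ).re := by simpa using ht
  have h := fourierIntegral_gaussian hb (k : ℂ)
  have hpt : ∀ θ : ℝ, Complex.exp (Complex.I * k * θ) * Complex.exp (-((t / 2 : ℝ) : ℂ) * θ ^ 2) =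
      ((Real.exp (-(t / 2) * θ ^ 2) : ℝ) : ℂ) * Complex.exp ((k * θ : ℝ) * Complex.I) := by
    intro θ
    rw [mul_comm]
    push_cast
    congr 2
    ring
  simp only [hpt] at h
  have hint : Integrable fun θ : ℝ =>
      ((Real.exp (-(t / 2) * θ ^ 2) : ℝ) : ℂ) * Complex.exp ((k * θ : ℝ) * Complex.I) := by
    refine (integrable_exp_neg_mul_sq (half_pos ht)).mono' (by
      apply Continuous.aestronglyMeasurable; fun_prop) (Eventually.of_forall fun θ => ?_)
    rw [norm_mul, Complex.norm_exp_ofReal_mul_I, mul_one, Complex.norm_real, Real.norm_eq_abs,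
      Real.abs_exp]
  have hre := integral_re hint
  rw [h] at hre
  have hrhs : ((Real.pi : ℂ) / ((t / 2 : ℝ) : ℂ)) ^ (1 / 2 : ℂ) *
      Complex.exp (-(k : ℂ) ^ 2 / (4 * ((t / 2 : ℝ) : ℂ))) =
      ((Real.sqrt (Real.pi / (t / 2)) * Real.exp (-(k : ℝ) ^ 2 / (2 * t)) : ℝ) : ℂ) := by
    rw [Real.sqrt_eq_rpow, Complex.ofReal_mul, Complex.ofReal_cpow (by positivity)]
    push_cast
    congr 2
    field_simp
    ring
  rw [hrhs] at hre
  simp only [RCLike.re_to_complex, Complex.ofReal_re, Complex.re_ofReal_mul,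
    Complex.exp_ofReal_mul_I_re] at hre
  rw [hre, gauss1, ← mul_assoc]
  congr 1
  have h1 : Real.pi / (t / 2) = (2 * Real.pi) ^ 2 / (2 * Real.pi * t) := by field_simp
  rw [h1, Real.sqrt_div (by positivity), Real.sqrt_sq (by positivity)]
  field_simp

lemma cos_sub_quadratic_le (θ : ℝ) : Real.cos θ - (1 - θ ^ 2 / 2) ≤ θ ^ 4 := by
  rcases le_or_gt |θ| 1 with h | h
  · have := (abs_le.1 (Real.cos_bound h)).2
    have h4 : |θ| ^ 4 = θ ^ 4 := by
      rw [show (4 : ℕ) = 2 * 2 from rfl, pow_mul, sq_abs, pow_mul]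
    rw [h4] at this
    nlinarith [sq_nonneg (θ ^ 2)]
  · have h2 : 1 ≤ θ ^ 2 := by
      rw [← sq_abs]; nlinarith
    nlinarith [Real.cos_le_one θ]

lemma abs_exp_neg_sub_exp_neg_le {a b m : ℝ} (ha : m ≤ a) (hb : m ≤ b) :
    |Real.exp (-a) - Real.exp (-b)| ≤ |a - b| * Real.exp (-m) := by
  wlog h : a ≤ b generalizing a b
  · rw [abs_sub_comm, abs_sub_comm a]
    exact this hb ha (le_of_not_ge h)
  have h1 : Real.exp (-b) ≤ Real.exp (-a) := Real.exp_le_exp.2 (by linarith)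
  rw [abs_of_nonneg (by linarith), abs_of_nonpos (by linarith)]
  have h2 : Real.exp (-b) = Real.exp (-a) * Real.exp (-(b - a)) := by
    rw [← Real.exp_add]; ring_nf
  have h3 : Real.exp (-a) ≤ Real.exp (-m) := Real.exp_le_exp.2 (by linarith)
  have h4 := Real.add_one_le_exp (-(b - a))
  rw [h2]
  nlinarith [Real.exp_pos (-a)]

lemma two_div_pi_sq_ge : 1 / 5 ≤ 2 / Real.pi ^ 2 := by
  rw [div_le_div_iff₀ (by norm_num) (by positivity)]
  nlinarith [Real.pi_lt_d2, Real.pi_pos]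

lemma mul_pow_four_mul_exp_le {t : ℝ} (ht : 0 < t) (θ : ℝ) :
    t * θ ^ 4 * Real.exp (-(t * θ ^ 2 / 5)) ≤ 200 / t * Real.exp (-(t / 10) * θ ^ 2) := by
  have h1 := Real.quadratic_le_exp_of_nonneg (x := t * θ ^ 2 / 10) (by positivity)
  have h2 : Real.exp (-(t / 10) * θ ^ 2) =
      Real.exp (t * θ ^ 2 / 10) * Real.exp (-(t * θ ^ 2 / 5)) := by
    rw [← Real.exp_add]; ring_nf
  rw [h2, ← mul_assoc]
  refine mul_le_mul_of_nonneg_right ?_ (Real.exp_pos _).le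
  have h3 : (t * θ ^ 2) ^ 2 ≤ 200 * Real.exp (t * θ ^ 2 / 10) := by
    nlinarith [mul_nonneg ht.le (sq_nonneg θ)]
  calc t * θ ^ 4 = (t * θ ^ 2) ^ 2 / t := by field_simp
    _ ≤ 200 * Real.exp (t * θ ^ 2 / 10) / t := by gcongr
    _ = _ := by ring

lemma abs_heat1_sub_gauss1_le {t : ℝ} (ht : 1 / 4 ≤ t) (k : ℤ) :
    |heat1 t k - gauss1 t k| ≤ 200 / (t * Real.sqrt t) := by
  have hpi := Real.pi_pos
  have hpi3 := Real.pi_gt_three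
  have ht0 : 0 < t := by linarith
  set f : ℝ → ℝ := (Set.Ioc (-Real.pi) Real.pi).indicator
    (fun θ => Real.exp (-t * (1 - Real.cos θ)) * Real.cos (k * θ)) with hf
  have hfi : Integrable f := by
    rw [hf, integrable_indicator_iff measurableSet_Ioc]
    apply Continuous.integrableOn_Ioc
    fun_prop
  have hq : heat1 t k = (2 * Real.pi)⁻¹ * ∫ θ, f θ := by
    rw [heat1, intervalIntegral.integral_of_le (by linarith), hf,
      integral_indicator measurableSet_Ioc]
  have hbound : ∀ θ : ℝ, ‖f θ - Real.exp (-(t / 2) * θ ^ 2) * Real.cos (k * θ)‖ ≤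
      200 / t * Real.exp (-(t / 10) * θ ^ 2) := by
    intro θ
    refine le_trans ?_ (mul_pow_four_mul_exp_le ht0 θ)
    have hcos := Real.abs_cos_le_one (k * θ)
    by_cases hθ : θ ∈ Set.Ioc (-Real.pi) Real.pi
    · rw [hf, Set.indicator_of_mem hθ, ← sub_mul, norm_mul, Real.norm_eq_abs, Real.norm_eq_abs]
      have hup := Real.cos_le_one_sub_mul_cos_sq (x := θ) (abs_le.2 ⟨hθ.1.le, hθ.2⟩)
      have h5 : 1 / 5 * θ ^ 2 ≤ 2 / Real.pi ^ 2 * θ ^ 2 :=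
        mul_le_mul_of_nonneg_right two_div_pi_sq_ge (sq_nonneg θ)
      have hlow := Real.one_sub_sq_div_two_le_cos (x := θ)
      have hqd := cos_sub_quadratic_le θ
      have h := abs_exp_neg_sub_exp_neg_le (a := t * (1 - Real.cos θ)) (b := t / 2 * θ ^ 2)
        (m := t * θ ^ 2 / 5) (by nlinarith) (by nlinarith [mul_nonneg ht0.le (sq_nonneg θ)])
      have habs : |t * (1 - Real.cos θ) - t / 2 * θ ^ 2| ≤ t * θ ^ 4 := by
        rw [show t * (1 - Real.cos θ) - t / 2 * θ ^ 2 = -(t * (Real.cos θ - (1 - θ ^ 2 / 2))) by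
          ring, abs_neg, abs_of_nonneg (mul_nonneg ht0.le (by linarith))]
        gcongr
      rw [neg_mul, neg_mul]
      calc _ ≤ |Real.exp (-(t * (1 - Real.cos θ))) - Real.exp (-(t / 2 * θ ^ 2))| * 1 := by gcongr
        _ ≤ |t * (1 - Real.cos θ) - t / 2 * θ ^ 2| * Real.exp (-(t * θ ^ 2 / 5)) := by
          rw [mul_one]; exact h
        _ ≤ _ := by gcongr
    · rw [hf, Set.indicator_of_notMem hθ, zero_sub, norm_neg, norm_mul, Real.norm_eq_abs,
        Real.norm_eq_abs, Real.abs_exp]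
      have h9 : 9 ≤ θ ^ 2 := by
        rw [Set.mem_Ioc, not_and_or] at hθ
        rcases hθ with h | h <;> nlinarith
      have h81 : 81 ≤ θ ^ 4 := by nlinarith
      have h1 : 1 ≤ t * θ ^ 4 := by nlinarith
      calc _ ≤ Real.exp (-(t / 2) * θ ^ 2) * 1 := by gcongr
        _ = 1 * Real.exp (-(t / 2) * θ ^ 2) := by ring
        _ ≤ _ := by
          gcongr
          nlinarith
  have hint := integrable_gauss_mul_cos ht0 k
  rw [hq, gauss1_eq_integral ht0, ← mul_sub, ← integral_sub hfi hint, abs_mul,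
    abs_of_pos (by positivity)]
  have hI : |∫ θ, (f θ - Real.exp (-(t / 2) * θ ^ 2) * Real.cos (k * θ))| ≤
      200 / t * Real.sqrt (Real.pi / (t / 10)) := by
    rw [← integral_gaussian (t / 10), ← integral_const_mul]
    exact norm_integral_le_of_norm_le
      ((integrable_exp_neg_mul_sq (by positivity)).const_mul _) (Eventually.of_forall hbound)
  have hs : Real.sqrt (Real.pi / (t / 10)) ≤ 2 * Real.pi / Real.sqrt t := by
    rw [show Real.pi / (t / 10) = 10 * Real.pi / t by field_simp, Real.sqrt_div (by positivity)]
    gcongr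
    rw [Real.sqrt_le_left (by positivity)]
    nlinarith
  have hst := Real.sqrt_pos.2 ht0
  calc _ ≤ (2 * Real.pi)⁻¹ * (200 / t * (2 * Real.pi / Real.sqrt t)) := by
        gcongr
        exact hI.trans (by gcongr)
    _ = _ := by field_simp

lemma abs_gauss1_le {t : ℝ} (ht : 0 < t) (k : ℤ) : |gauss1 t k| ≤ 1 / Real.sqrt t := by
  have hpi := Real.pi_gt_three
  have hst := Real.sqrt_pos.2 ht
  rw [gauss1, abs_mul, Real.abs_exp, abs_of_nonneg (by positivity)]
  have h1 : Real.exp (-(k : ℝ) ^ 2 / (2 * t)) ≤ 1 := by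
    rw [Real.exp_le_one_iff]
    apply div_nonpos_of_nonpos_of_nonneg <;> nlinarith [sq_nonneg (k : ℝ)]
  have h2 : Real.sqrt t ≤ Real.sqrt (2 * Real.pi * t) := Real.sqrt_le_sqrt (by nlinarith)
  calc _ ≤ (Real.sqrt t)⁻¹ * 1 := by gcongr
    _ = _ := by ring

lemma abs_heat1_le {t : ℝ} (ht : 1 / 4 ≤ t) (k : ℤ) : |heat1 t k| ≤ 801 / Real.sqrt t := by
  have ht0 : 0 < t := by linarith
  have hst := Real.sqrt_pos.2 ht0
  have h1 := abs_heat1_sub_gauss1_le ht k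
  have h2 := abs_gauss1_le ht0 k
  have h3 : |heat1 t k| ≤ |heat1 t k - gauss1 t k| + |gauss1 t k| := by
    simpa using abs_add_le (heat1 t k - gauss1 t k) (gauss1 t k)
  have h4 : 200 / (t * Real.sqrt t) ≤ 800 / Real.sqrt t := by
    rw [div_le_div_iff₀ (by positivity) hst]
    nlinarith
  have h5 : 801 / Real.sqrt t = 800 / Real.sqrt t + 1 / Real.sqrt t := by ring
  linarith

/-- The average of `f` over the nearest neighbours of `x` in `ℤ^4`. -/
noncomputable def avg (f : (Fin 4 → ℤ) → ℝ) (x : Fin 4 → ℤ) : ℝ :=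
  (2 * ((4 : ℕ) : ℝ))⁻¹ * ∑ e ∈ steps 4, f (x + e)

lemma sum_steps (f : (Fin 4 → ℤ) → ℝ) :
    ∑ e ∈ steps 4, f e = ∑ i, (f (Pi.single i 1) + f (Pi.single i (-1))) := by
  unfold steps
  rw [Finset.sum_image]
  · rw [Fintype.sum_prod_type]
    refine Finset.sum_congr rfl fun i _ => ?_
    rw [Fintype.sum_bool]
    congr 2 <;>
    · funext j
      simp [Pi.single_apply]
  · rintro ⟨i, a⟩ - ⟨j, b⟩ - h
    have h1 := congrFun h i
    simp only [if_true] at h1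
    have hij : i = j := by
      by_contra hne
      rw [if_neg hne] at h1
      cases a <;> simp at h1
    subst hij
    cases a <;> cases b <;> simp_all

lemma avg_eq (f : (Fin 4 → ℤ) → ℝ) (x : Fin 4 → ℤ) :
    avg f x = 8⁻¹ * ∑ i, (f (x + Pi.single i 1) + f (x + Pi.single i (-1))) := by
  rw [avg, sum_steps fun e => f (x + e)]
  norm_num

lemma card_steps : ((steps 4).card : ℝ) = 8 := by
  have := sum_steps fun _ => 1
  simp at this
  rw [this]
  norm_num

lemma avg_add (f g : (Fin 4 → ℤ) → ℝ) (x : Fin 4 → ℤ) :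
    avg (fun z => f z + g z) x = avg f x + avg g x := by
  simp only [avg, Finset.sum_add_distrib, mul_add]

lemma avg_const_mul (c : ℝ) (f : (Fin 4 → ℤ) → ℝ) (x : Fin 4 → ℤ) :
    avg (fun z => c * f z) x = c * avg f x := by
  simp only [avg, ← Finset.mul_sum]
  ring

lemma avg_sub (f g : (Fin 4 → ℤ) → ℝ) (x : Fin 4 → ℤ) :
    avg (fun z => f z - g z) x = avg f x - avg g x := by
  simp only [avg, Finset.sum_sub_distrib, mul_sub]

lemma avg_const (c : ℝ) (x : Fin 4 → ℤ) : avg (fun _ => c) x = c := by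
  simp only [avg, Finset.sum_const, nsmul_eq_mul, card_steps]
  push_cast
  ring

lemma avg_comp_sub (f : (Fin 4 → ℤ) → ℝ) (x y : Fin 4 → ℤ) :
    avg (fun z => f (z - y)) x = avg f (x - y) := by
  simp only [avg, sub_add_eq_add_sub]

lemma nrm_eq_norm {d : ℕ} (x : Fin d → ℤ) :
    nrm x = ‖(WithLp.toLp 2 fun i => (x i : ℝ) : EuclideanSpace ℝ (Fin d))‖ := by
  simp [nrm, EuclideanSpace.norm_eq]

lemma nrm_nonneg {d : ℕ} (x : Fin d → ℤ) : 0 ≤ nrm x := Real.sqrt_nonneg _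

lemma nrm_sq {d : ℕ} (x : Fin d → ℤ) : nrm x ^ 2 = ∑ i, (x i : ℝ) ^ 2 :=
  Real.sq_sqrt (Finset.sum_nonneg fun _ _ => sq_nonneg _)

lemma nrm_add_le {d : ℕ} (x y : Fin d → ℤ) : nrm (x + y) ≤ nrm x + nrm y := by
  have h : (WithLp.toLp 2 fun i => ((x + y) i : ℝ) : EuclideanSpace ℝ (Fin d)) =
      WithLp.toLp 2 (fun i => (x i : ℝ)) + WithLp.toLp 2 (fun i => (y i : ℝ)) := by
    ext i
    simp
  rw [nrm_eq_norm, nrm_eq_norm, nrm_eq_norm, h]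
  exact norm_add_le _ _

lemma nrm_neg {d : ℕ} (x : Fin d → ℤ) : nrm (-x) = nrm x := by
  simp [nrm]

lemma nrm_sub_le {d : ℕ} (x y : Fin d → ℤ) : nrm (x - y) ≤ nrm x + nrm y := by
  rw [sub_eq_add_neg, ← nrm_neg y]
  exact nrm_add_le _ _

lemma le_nrm_sub {d : ℕ} (x y : Fin d → ℤ) : nrm x - nrm y ≤ nrm (x - y) := by
  have := nrm_add_le (x - y) y
  rw [sub_add_cancel] at this
  linarith

lemma one_le_nrm {d : ℕ} {x : Fin d → ℤ} (hx : x ≠ 0) : 1 ≤ nrm x := by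
  obtain ⟨i, hi⟩ := Function.ne_iff.1 hx
  rw [nrm, Real.one_le_sqrt]
  have h1 : (1 : ℝ) ≤ (x i : ℝ) ^ 2 := by
    have : (1 : ℤ) ≤ x i ^ 2 := Int.add_one_le_iff.2 
      (lt_of_le_of_ne (sq_nonneg _) (pow_ne_zero 2 hi).symm)
    exact_mod_cast this
  exact h1.trans (Finset.single_le_sum (f := fun i => (x i : ℝ) ^ 2)
    (fun _ _ => sq_nonneg _) (Finset.mem_univ i))

lemma nrm_of_mem_steps {e : Fin 4 → ℤ} (he : e ∈ steps 4) : nrm e = 1 := by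
  simp only [steps, Finset.mem_image, Finset.mem_univ, true_and] at he
  obtain ⟨⟨i, b⟩, rfl⟩ := he
  rw [nrm, Real.sqrt_eq_one, Finset.sum_eq_single i]
  · cases b <;> simp
  · intro j _ hj
    simp [hj]
  · simp

lemma exists_nrm_le_two_mul_abs (x : Fin 4 → ℤ) : ∃ i, nrm x ≤ 2 * |(x i : ℝ)| := by
  obtain ⟨i, -, hi⟩ := Finset.exists_max_image Finset.univ (fun i => |(x i : ℝ)|)
    Finset.univ_nonempty
  refine ⟨i, Real.sqrt_le_iff.2 ⟨by positivity, ?_⟩⟩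
  calc ∑ j, (x j : ℝ) ^ 2 ≤ ∑ _j : Fin 4, |(x i : ℝ)| ^ 2 := by
        refine Finset.sum_le_sum fun j _ => ?_
        rw [← sq_abs]
        exact pow_le_pow_left₀ (abs_nonneg _) (hi j (Finset.mem_univ j)) 2
    _ = (2 * |(x i : ℝ)|) ^ 2 := by
        rw [Finset.sum_const, Finset.card_univ, Fintype.card_fin, nsmul_eq_mul]
        push_cast
        ring

/-- Transition probability at time `t` of the rate one continuous-time simple random walk
on `ℤ^4` started at the origin. -/
noncomputable def heat (t : ℝ) (x : Fin 4 → ℤ) : ℝ := ∏ i, heat1 (t / 4) (x i)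

lemma hasDerivAt_heat (t : ℝ) (x : Fin 4 → ℤ) :
    HasDerivAt (fun s => heat s x) (avg (heat t) x - heat t x) t := by
  have h (k : ℤ) : HasDerivAt (fun s => heat1 (s / 4) k)
      (((heat1 (t / 4) (k + 1) + heat1 (t / 4) (k - 1)) / 2 - heat1 (t / 4) k) * (1 / 4)) t :=
    HasDerivAt.comp (h₂ := fun s => heat1 s k) t (hasDerivAt_heat1 (t / 4) k)
      ((hasDerivAt_id t).div_const 4)
  have hp := (((h (x 0)).mul (h (x 1))).mul (h (x 2))).mul (h (x 3))
  rw [avg_eq]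
  unfold heat
  simp only [Fin.prod_univ_four, Fin.sum_univ_four]
  refine hp.congr_deriv ?_
  simp [sub_eq_add_neg]
  ring

lemma continuous_heat (x : Fin 4 → ℤ) : Continuous fun t => heat t x :=
  continuous_iff_continuousAt.2 fun t => (hasDerivAt_heat t x).continuousAt

lemma heat_zero (x : Fin 4 → ℤ) : heat 0 x = if x = 0 then 1 else 0 := by
  simp only [heat, zero_div, heat1_zero]
  rw [Finset.prod_ite_zero]
  simp [funext_iff]

/-- The Gaussian density approximating `heat`. -/
noncomputable def gauss (t : ℝ) (x : Fin 4 → ℤ) : ℝ :=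
  4 / Real.pi ^ 2 / t ^ 2 * Real.exp (-(2 * nrm x ^ 2 / t))

lemma prod_gauss1 {t : ℝ} (ht : 0 < t) (x : Fin 4 → ℤ) :
    ∏ i, gauss1 (t / 4) (x i) = gauss t x := by
  have hpi := Real.pi_pos
  simp only [gauss1, Finset.prod_mul_distrib, Finset.prod_const, Finset.card_univ,
    Fintype.card_fin, ← Real.exp_sum, gauss, nrm_sq]
  congr 1
  · rw [inv_pow, show (4 : ℕ) = 2 * 2 from rfl, pow_mul, Real.sq_sqrt (by positivity)]
    field_simp
    ring
  · congr 1
    rw [Finset.mul_sum, Finset.sum_div, ← Finset.sum_neg_distrib]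
    refine Finset.sum_congr rfl fun i _ => ?_
    field_simp
    ring

lemma abs_prod_four_sub_le {A ε : ℝ} {a b : Fin 4 → ℝ} (hA : 0 ≤ A)
    (ha : ∀ i, |a i| ≤ A) (hb : ∀ i, |b i| ≤ A) (hab : ∀ i, |a i - b i| ≤ ε) :
    |∏ i, a i - ∏ i, b i| ≤ 4 * A ^ 3 * ε := by
  have hm {u v w z : ℝ} (hu : |u| ≤ A) (hv : |v| ≤ A) (hw : |w| ≤ A) (hz : |z| ≤ ε) :
      |u * v * w * z| ≤ A ^ 3 * ε := by
    rw [abs_mul, abs_mul, abs_mul]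
    calc |u| * |v| * |w| * |z| ≤ A * A * A * ε := by gcongr
      _ = _ := by ring
  have h : ∏ i, a i - ∏ i, b i = a 0 * a 1 * a 2 * (a 3 - b 3) + a 0 * a 1 * b 3 * (a 2 - b 2)
      + a 0 * b 2 * b 3 * (a 1 - b 1) + b 1 * b 2 * b 3 * (a 0 - b 0) := by
    simp only [Fin.prod_univ_four]
    ring
  rw [h]
  have h1 := hm (ha 0) (ha 1) (ha 2) (hab 3)
  have h2 := hm (ha 0) (ha 1) (hb 3) (hab 2)
  have h3 := hm (ha 0) (hb 2) (hb 3) (hab 1)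
  have h4 := hm (hb 1) (hb 2) (hb 3) (hab 0)
  rw [abs_le] at *
  constructor <;> linarith

lemma exists_abs_heat_sub_gauss_le :
    ∃ C, 0 ≤ C ∧ ∀ t : ℝ, 1 ≤ t → ∀ x, |heat t x - gauss t x| ≤ C / t ^ 3 := by
  refine ⟨4 * 801 ^ 3 * 200 * 64, by norm_num, fun t ht x => ?_⟩
  have ht4 : 1 / 4 ≤ t / 4 := by linarith
  have ht0 : 0 < t / 4 := by linarith
  have hst := Real.sqrt_pos.2 ht0
  have h := abs_prod_four_sub_le (A := 801 / Real.sqrt (t / 4))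
    (ε := 200 / (t / 4 * Real.sqrt (t / 4))) (a := fun i => heat1 (t / 4) (x i))
    (b := fun i => gauss1 (t / 4) (x i)) (by positivity) (fun i => abs_heat1_le ht4 _)
    (fun i => (abs_gauss1_le ht0 _).trans (by gcongr; norm_num))
    (fun i => abs_heat1_sub_gauss1_le ht4 _)
  rw [prod_gauss1 (by linarith)] at h
  refine h.trans_eq ?_
  have hs : Real.sqrt (t / 4) ^ 4 = (t / 4) ^ 2 := by
    rw [show (4 : ℕ) = 2 * 2 from rfl, pow_mul, Real.sq_sqrt ht0.le]
  have : 4 * (801 / Real.sqrt (t / 4)) ^ 3 * (200 / (t / 4 * Real.sqrt (t / 4))) =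
      4 * 801 ^ 3 * 200 / (t / 4 * Real.sqrt (t / 4) ^ 4) := by
    field_simp
  rw [this, hs]
  field_simp
  norm_num

lemma exists_abs_heat_le : ∃ C, 0 ≤ C ∧ ∀ t : ℝ, 1 ≤ t → ∀ x, |heat t x| ≤ C / t ^ 2 := by
  refine ⟨801 ^ 4 * 16, by norm_num, fun t ht x => ?_⟩
  have ht4 : 1 / 4 ≤ t / 4 := by linarith
  have ht0 : 0 < t / 4 := by linarith
  rw [heat, Finset.abs_prod]
  calc ∏ i, |heat1 (t / 4) (x i)| ≤ ∏ _i : Fin 4, 801 / Real.sqrt (t / 4) :=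
        Finset.prod_le_prod (fun _ _ => abs_nonneg _) fun i _ => abs_heat1_le ht4 _
    _ = 801 ^ 4 * 16 / t ^ 2 := by
        have hs : Real.sqrt (t / 4) ^ 4 = (t / 4) ^ 2 := by
          rw [show (4 : ℕ) = 2 * 2 from rfl, pow_mul, Real.sq_sqrt ht0.le]
        rw [Finset.prod_const, Finset.card_univ, Fintype.card_fin, div_pow, hs]
        field_simp
        norm_num

lemma cosh_sub_one_le_sq {u : ℝ} (h0 : 0 ≤ u) (h1 : u ≤ 1) : Real.cosh u - 1 ≤ u ^ 2 := by
  have h := Real.cosh_le_exp_half_sq u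
  have h2 : |u ^ 2 / 2| ≤ 1 := by
    rw [abs_of_nonneg (by positivity)]
    nlinarith
  have h3 := (abs_le.1 (Real.abs_exp_sub_one_le h2)).2
  rw [abs_of_nonneg (by positivity)] at h3
  linarith

lemma pow_le_mul_exp_half {s : ℝ} (hs : 0 ≤ s) :
    s ^ 24 ≤ 2 ^ 24 * (Nat.factorial 24 : ℝ) * Real.exp (s / 2) := by
  have h := Real.pow_div_factorial_le_exp (x := s / 2) (by positivity) 24
  rw [div_le_iff₀ (by positivity), div_pow, div_le_iff₀ (by positivity)] at h
  linarith

lemma exists_abs_heat_le_of_le : ∃ C, 0 ≤ C ∧ ∀ s t : ℝ, ∀ x, 1 ≤ s → nrm x = s ^ 4 →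
    0 ≤ t → t ≤ s ^ 6 → |heat t x| ≤ C / s ^ 24 := by
  refine ⟨Real.exp 1 * (2 ^ 24 * (Nat.factorial 24 : ℝ)), by positivity,
    fun s t x hs hx ht0 ht => ?_⟩
  have hs0 : 0 < s := by linarith
  obtain ⟨i, hi⟩ := exists_nrm_le_two_mul_abs x
  have h1 : |heat t x| ≤ |heat1 (t / 4) (x i)| := by
    rw [heat, Finset.abs_prod, ← Finset.mul_prod_erase _ _ (Finset.mem_univ i)]
    refine mul_le_of_le_one_right (abs_nonneg _) ?_
    exact Finset.prod_le_one (fun _ _ => abs_nonneg _)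
      fun j _ => abs_heat1_le_one (by linarith) _
  have h2 := abs_heat1_le_exp (t := t / 4) (lam := 1 / s ^ 3) (by linarith) (x i)
  have h3 := cosh_sub_one_le_sq (u := 1 / s ^ 3) (by positivity)
    (by rw [div_le_one (by positivity)]; exact one_le_pow₀ hs)
  have h4 : t / 4 * (Real.cosh (1 / s ^ 3) - 1) ≤ 1 := by
    calc _ ≤ t / 4 * (1 / s ^ 3) ^ 2 := by gcongr
      _ ≤ s ^ 6 / 4 * (1 / s ^ 3) ^ 2 := by gcongr
      _ = 1 / 4 := by field_simp
      _ ≤ 1 := by norm_num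
  have h5 : s / 2 ≤ 1 / s ^ 3 * |(x i : ℝ)| := by
    rw [one_div, ← div_eq_inv_mul, le_div_iff₀ (by positivity)]
    rw [hx] at hi
    nlinarith
  have h6 : |heat t x| ≤ Real.exp 1 * (Real.exp (s / 2))⁻¹ := by
    refine (h1.trans h2).trans ?_
    rw [← Real.exp_neg, ← Real.exp_add]
    exact Real.exp_le_exp.2 (by linarith)
  refine h6.trans ?_
  have h7 := pow_le_mul_exp_half hs0.le
  rw [← div_eq_mul_inv, div_le_div_iff₀ (Real.exp_pos _) (by positivity), mul_assoc]
  gcongr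

lemma continuous_avg_heat (x : Fin 4 → ℤ) : Continuous fun t => avg (heat t) x := by
  unfold avg
  exact continuous_const.mul (continuous_finsetSum _ fun e _ => continuous_heat (x + e))

/-- The expected time spent at `x` up to time `M` by the continuous-time walk. -/
noncomputable def green (M : ℝ) (x : Fin 4 → ℤ) : ℝ := ∫ t in (0 : ℝ)..M, heat t x

/-- The first time moment of the heat kernel up to time `M`; its negative is a potential
of `green M`. -/
noncomputable def biharm (M : ℝ) (x : Fin 4 → ℤ) : ℝ := ∫ t in (0 : ℝ)..M, t * heat t x

lemma avg_integral {f : ℝ → (Fin 4 → ℤ) → ℝ} (hf : ∀ x, Continuous fun t => f t x) (M : ℝ)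
    (x : Fin 4 → ℤ) :
    avg (fun z => ∫ t in (0 : ℝ)..M, f t z) x = ∫ t in (0 : ℝ)..M, avg (f t) x := by
  unfold avg
  rw [intervalIntegral.integral_const_mul, intervalIntegral.integral_finsetSum]
  exact fun e _ => (hf _).intervalIntegrable _ _

lemma green_sub_avg (M : ℝ) (x : Fin 4 → ℤ) :
    green M x - avg (green M) x = (if x = 0 then 1 else 0) - heat M x := by
  have h := intervalIntegral.integral_eq_sub_of_hasDerivAt (a := 0) (b := M)
    (fun t _ => hasDerivAt_heat t x)
    (((continuous_avg_heat x).sub (continuous_heat x)).intervalIntegrable _ _)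
  rw [intervalIntegral.integral_sub ((continuous_avg_heat x).intervalIntegrable _ _)
    ((continuous_heat x).intervalIntegrable _ _), ← avg_integral continuous_heat, heat_zero] at h
  change avg (green M) x - green M x = _ at h
  linarith

lemma biharm_sub_avg (M : ℝ) (x : Fin 4 → ℤ) :
    biharm M x - avg (biharm M) x = green M x - M * heat M x := by
  have hc : ∀ x, Continuous fun t : ℝ => t * heat t x :=
    fun x => continuous_id.mul (continuous_heat x)
  have hca : Continuous fun t : ℝ => avg (fun z => t * heat t z) x := by
    simp only [avg_const_mul]
    exact continuous_id.mul (continuous_avg_heat x)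
  have hd : ∀ t : ℝ, HasDerivAt (fun t => t * heat t x)
      (heat t x + (avg (fun z => t * heat t z) x - t * heat t x)) t := by
    intro t
    refine ((hasDerivAt_id t).mul (hasDerivAt_heat t x)).congr_deriv ?_
    rw [avg_const_mul]
    simp
    ring
  have hsub : Continuous fun t : ℝ => avg (fun z => t * heat t z) x - t * heat t x :=
    hca.sub (hc x)
  have h := intervalIntegral.integral_eq_sub_of_hasDerivAt (a := 0) (b := M)
    (fun t _ => hd t) (((continuous_heat x).add hsub).intervalIntegrable _ _)
  rw [intervalIntegral.integral_add ((continuous_heat x).intervalIntegrable _ _)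
    (hsub.intervalIntegrable _ _),
    intervalIntegral.integral_sub (hca.intervalIntegrable _ _)
    ((hc x).intervalIntegrable _ _), ← avg_integral hc] at h
  change green M x + (avg (biharm M) x - biharm M x) = _ at h
  linarith

lemma integral_inv_sq_le {T M : ℝ} (hT : 0 < T) (hTM : T ≤ M) :
    ∫ t in T..M, 1 / t ^ 2 ≤ 1 / T := by
  have hne : ∀ t ∈ Set.uIcc T M, t ≠ 0 := fun t ht => by
    rw [Set.uIcc_of_le hTM] at ht
    linarith [ht.1]
  have h := intervalIntegral.integral_eq_sub_of_hasDerivAt (a := T) (b := M)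
    (f := fun t => -t⁻¹) (f' := fun t => 1 / t ^ 2)
    (fun t ht => ((hasDerivAt_inv (hne t ht)).neg).congr_deriv (by simp))
    (ContinuousOn.intervalIntegrable
      (continuousOn_const.div (by fun_prop) fun t ht => pow_ne_zero _ (hne t ht)))
  rw [h]
  have : 0 < M⁻¹ := inv_pos.2 (by linarith)
  rw [one_div]
  linarith

lemma integral_inv_cube_le {T M : ℝ} (hT : 0 < T) (hTM : T ≤ M) :
    ∫ t in T..M, 1 / t ^ 3 ≤ 1 / T ^ 2 := by
  have hne : ∀ t ∈ Set.uIcc T M, t ≠ 0 := fun t ht => by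
    rw [Set.uIcc_of_le hTM] at ht
    linarith [ht.1]
  have h := intervalIntegral.integral_eq_sub_of_hasDerivAt (a := T) (b := M)
    (f := fun t => -(t ^ 2)⁻¹ / 2) (f' := fun t => 1 / t ^ 3)
    (fun t ht => ((((hasDerivAt_pow 2 t).inv (pow_ne_zero 2 (hne t ht))).neg).div_const 2).congr_deriv
      (by have := hne t ht; field_simp; norm_num; ring))
    (ContinuousOn.intervalIntegrable
      (continuousOn_const.div (by fun_prop) fun t ht => pow_ne_zero _ (hne t ht)))
  rw [h]
  have h1 : 0 < (M ^ 2)⁻¹ := inv_pos.2 (pow_pos (by linarith) 2)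
  have h2 : 0 < (T ^ 2)⁻¹ := inv_pos.2 (pow_pos hT 2)
  rw [one_div]
  linarith

lemma continuousOn_gauss {T M : ℝ} (hT : 0 < T) (hTM : T ≤ M) (x : Fin 4 → ℤ) :
    ContinuousOn (fun t => gauss t x) (Set.uIcc T M) := by
  have hne : ∀ t ∈ Set.uIcc T M, t ≠ 0 := fun t ht => by
    rw [Set.uIcc_of_le hTM] at ht
    linarith [ht.1]
  unfold gauss
  refine (continuousOn_const.div (by fun_prop) fun t ht => pow_ne_zero _ (hne t ht)).mul ?_
  exact (continuousOn_const.div continuousOn_id hne).neg.rexp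

lemma integral_gauss {T M : ℝ} (hT : 0 < T) (hTM : T ≤ M) {x : Fin 4 → ℤ} (hx : x ≠ 0) :
    ∫ t in T..M, gauss t x = 2 / Real.pi ^ 2 / nrm x ^ 2 *
      (Real.exp (-(2 * nrm x ^ 2 / M)) - Real.exp (-(2 * nrm x ^ 2 / T))) := by
  have hr := one_le_nrm hx
  have hr0 : nrm x ≠ 0 := by linarith
  have hpi := Real.pi_ne_zero
  have hne : ∀ t ∈ Set.uIcc T M, t ≠ 0 := fun t ht => by
    rw [Set.uIcc_of_le hTM] at ht
    linarith [ht.1]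
  have hd : ∀ t ∈ Set.uIcc T M, HasDerivAt
      (fun t => 2 / Real.pi ^ 2 / nrm x ^ 2 * Real.exp (-(2 * nrm x ^ 2 / t))) (gauss t x) t := by
    intro t ht
    have ht0 := hne t ht
    have h1 : HasDerivAt (fun t => -(2 * nrm x ^ 2 / t)) (2 * nrm x ^ 2 / t ^ 2) t := by
      have := (((hasDerivAt_inv ht0).const_mul (2 * nrm x ^ 2)).neg)
      exact this.congr_deriv (by ring)
    refine (h1.exp.const_mul (2 / Real.pi ^ 2 / nrm x ^ 2)).congr_deriv ?_
    unfold gauss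
    field_simp
    ring
  rw [intervalIntegral.integral_eq_sub_of_hasDerivAt hd
    (continuousOn_gauss hT hTM x).intervalIntegrable]
  ring

/-- Splitting `∫₀ᴹ w(t) heat t x dt` at time `s ^ 6`, where `|x| = s ^ 4`. -/
lemma exists_abs_integral_heat_sub_le : ∃ C, 0 ≤ C ∧ ∀ (M s : ℝ) (x : Fin 4 → ℤ), 1 ≤ s →
    nrm x = s ^ 4 → s ^ 6 ≤ M →
    |green M x - ∫ t in (s ^ 6)..M, gauss t x| ≤ C / s ^ 12 ∧
    |biharm M x - ∫ t in (s ^ 6)..M, t * gauss t x| ≤ C / s ^ 6 := by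
  obtain ⟨C₁, hC₁, h₁⟩ := exists_abs_heat_sub_gauss_le
  obtain ⟨C₂, hC₂, h₂⟩ := exists_abs_heat_le_of_le
  refine ⟨C₁ + C₂, by positivity, fun M s x hs hx hM => ?_⟩
  have hs0 : 0 < s := by linarith
  have hT1 : 1 ≤ s ^ 6 := one_le_pow₀ hs
  have hT : 0 < s ^ 6 := by positivity
  have hpos : ∀ t ∈ Set.Ioc (s ^ 6) M, 0 < t := fun t ht => hT.trans ht.1
  have hch := continuous_heat x
  have hcth : Continuous fun t : ℝ => t * heat t x := continuous_id.mul hch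
  have hgi := (continuousOn_gauss hT hM x).intervalIntegrable (μ := volume)
  have htgi : IntervalIntegrable (fun t => t * gauss t x) volume (s ^ 6) M :=
    (continuousOn_id.mul (continuousOn_gauss hT hM x)).intervalIntegrable
  have hne : ∀ t ∈ Set.uIcc (s ^ 6) M, t ≠ 0 := fun t ht => by
    rw [Set.uIcc_of_le hM] at ht
    linarith [ht.1]
  have hpi (n : ℕ) : IntervalIntegrable (fun t : ℝ => C₁ * (1 / t ^ n)) volume (s ^ 6) M :=
    (ContinuousOn.intervalIntegrable
      (continuousOn_const.div (by fun_prop) fun t ht => pow_ne_zero _ (hne t ht))).const_mul _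
  have hA : |∫ t in (0 : ℝ)..s ^ 6, heat t x| ≤ C₂ / s ^ 24 * |s ^ 6 - 0| := by
    rw [← Real.norm_eq_abs]
    refine intervalIntegral.norm_integral_le_of_norm_le_const fun t ht => ?_
    rw [Set.uIoc_of_le hT.le] at ht
    exact h₂ s t x hs hx ht.1.le ht.2
  have hA' : |∫ t in (0 : ℝ)..s ^ 6, t * heat t x| ≤ s ^ 6 * (C₂ / s ^ 24) * |s ^ 6 - 0| := by
    rw [← Real.norm_eq_abs]
    refine intervalIntegral.norm_integral_le_of_norm_le_const fun t ht => ?_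
    rw [Set.uIoc_of_le hT.le] at ht
    rw [norm_mul, Real.norm_of_nonneg ht.1.le]
    exact mul_le_mul ht.2 (h₂ s t x hs hx ht.1.le ht.2) (norm_nonneg _) hT.le
  have hB : |∫ t in (s ^ 6)..M, (heat t x - gauss t x)| ≤ C₁ * (1 / (s ^ 6) ^ 2) := by
    calc _ ≤ ∫ t in (s ^ 6)..M, C₁ * (1 / t ^ 3) := by
          rw [← Real.norm_eq_abs]
          refine intervalIntegral.norm_integral_le_of_norm_le hM
            (Eventually.of_forall fun t ht => ?_) (hpi 3)
          have := h₁ t (hT1.trans ht.1.le) x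
          rwa [Real.norm_eq_abs, mul_one_div]
      _ ≤ _ := by
          rw [intervalIntegral.integral_const_mul]
          exact mul_le_mul_of_nonneg_left (integral_inv_cube_le hT hM) hC₁
  have hB' : |∫ t in (s ^ 6)..M, (t * heat t x - t * gauss t x)| ≤ C₁ * (1 / s ^ 6) := by
    calc _ ≤ ∫ t in (s ^ 6)..M, C₁ * (1 / t ^ 2) := by
          rw [← Real.norm_eq_abs]
          refine intervalIntegral.norm_integral_le_of_norm_le hM
            (Eventually.of_forall fun t ht => ?_) (hpi 2)
          have ht0 := hpos t ht
          have := h₁ t (hT1.trans ht.1.le) x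
          rw [← mul_sub, norm_mul, Real.norm_of_nonneg ht0.le, Real.norm_eq_abs]
          calc _ ≤ t * (C₁ / t ^ 3) := by gcongr
            _ = _ := by field_simp
      _ ≤ _ := by
          rw [intervalIntegral.integral_const_mul]
          exact mul_le_mul_of_nonneg_left (integral_inv_sq_le hT hM) hC₁
  rw [sub_zero, abs_of_pos hT] at hA hA'
  constructor
  · rw [green, ← intervalIntegral.integral_add_adjacent_intervals
      (hch.intervalIntegrable 0 (s ^ 6)) (hch.intervalIntegrable (s ^ 6) M), add_sub_assoc,
      ← intervalIntegral.integral_sub (hch.intervalIntegrable _ _) hgi]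
    refine (abs_add_le _ _).trans ?_
    have e1 : C₂ / s ^ 24 * s ^ 6 ≤ C₂ / s ^ 12 := by
      calc C₂ / s ^ 24 * s ^ 6 = C₂ / s ^ 18 := by field_simp
        _ ≤ _ := by gcongr; norm_num
    have e2 : C₁ * (1 / (s ^ 6) ^ 2) = C₁ / s ^ 12 := by
      rw [← pow_mul]; ring
    rw [add_div]
    linarith
  · rw [biharm, ← intervalIntegral.integral_add_adjacent_intervals
      (hcth.intervalIntegrable 0 (s ^ 6)) (hcth.intervalIntegrable (s ^ 6) M), add_sub_assoc,
      ← intervalIntegral.integral_sub (hcth.intervalIntegrable _ _) htgi]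
    refine (abs_add_le _ _).trans ?_
    have e1 : s ^ 6 * (C₂ / s ^ 24) * s ^ 6 ≤ C₂ / s ^ 6 := by
      calc s ^ 6 * (C₂ / s ^ 24) * s ^ 6 = C₂ / s ^ 12 := by field_simp
        _ ≤ _ := by gcongr; norm_num
    have e2 : C₁ * (1 / s ^ 6) = C₁ / s ^ 6 := by ring
    rw [add_div]
    linarith

lemma exists_pow_four_eq_nrm {x : Fin 4 → ℤ} (hx : x ≠ 0) : ∃ s, 1 ≤ s ∧ nrm x = s ^ 4 := by
  have h := one_le_nrm hx
  refine ⟨Real.sqrt (Real.sqrt (nrm x)), ?_, ?_⟩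
  · rw [Real.one_le_sqrt, Real.one_le_sqrt]
    exact h
  · rw [show ∀ u : ℝ, u ^ 4 = (u ^ 2) ^ 2 from fun u => by ring, Real.sq_sqrt (Real.sqrt_nonneg _),
      Real.sq_sqrt (nrm_nonneg x)]

lemma exists_abs_green_sub_le : ∃ C, 0 ≤ C ∧ ∀ (M : ℝ) (x : Fin 4 → ℤ), x ≠ 0 →
    nrm x ^ 2 ≤ M →
    |green M x - 2 / Real.pi ^ 2 / nrm x ^ 2| ≤ C * (1 / nrm x ^ 3 + 1 / M) := by
  obtain ⟨C, hC, h⟩ := exists_abs_integral_heat_sub_le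
  refine ⟨C + 2, by positivity, fun M x hx hM => ?_⟩
  obtain ⟨s, hs, hxs⟩ := exists_pow_four_eq_nrm hx
  have hs0 : 0 < s := by linarith
  have hTM : s ^ 6 ≤ M := by
    refine le_trans ?_ hM
    rw [hxs, ← pow_mul]
    exact pow_le_pow_right₀ hs (by norm_num)
  have hM0 : 0 < M := lt_of_lt_of_le (by positivity) hTM
  have h1 := (h M s x hs hxs hTM).1
  rw [integral_gauss (by positivity) hTM hx] at h1
  set a := 2 / Real.pi ^ 2 / nrm x ^ 2 with ha
  have hpi3 := Real.pi_gt_three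
  have ha0 : 0 < a := by rw [ha, hxs]; positivity
  have ha1 : a ≤ 1 / nrm x ^ 2 := by
    rw [ha, hxs]
    gcongr
    rw [div_le_one (by positivity)]
    nlinarith
  have e1 : 0 ≤ 1 - Real.exp (-(2 * nrm x ^ 2 / M)) := by
    rw [sub_nonneg, Real.exp_le_one_iff, neg_nonpos]
    positivity
  have e2 : 1 - Real.exp (-(2 * nrm x ^ 2 / M)) ≤ 2 * nrm x ^ 2 / M := by
    linarith [Real.add_one_le_exp (-(2 * nrm x ^ 2 / M))]
  have e3 : Real.exp (-(2 * nrm x ^ 2 / s ^ 6)) ≤ 1 / nrm x := by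
    rw [Real.exp_neg, ← one_div]
    apply one_div_le_one_div_of_le (by rw [hxs]; positivity)
    have e4 : 2 * nrm x ^ 2 / s ^ 6 = 2 * s ^ 2 := by
      rw [hxs]; field_simp
    have := Real.quadratic_le_exp_of_nonneg (x := 2 * s ^ 2) (by positivity)
    rw [e4, hxs]
    nlinarith [sq_nonneg s]
  have hr0 : 0 < nrm x := by linarith [one_le_nrm hx]
  have f1 : a * (1 - Real.exp (-(2 * nrm x ^ 2 / M))) ≤ 2 * (1 / M) := by
    calc _ ≤ 1 / nrm x ^ 2 * (2 * nrm x ^ 2 / M) := by gcongr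
      _ = _ := by field_simp
  have f2 : a * Real.exp (-(2 * nrm x ^ 2 / s ^ 6)) ≤ 1 / nrm x ^ 3 := by
    calc _ ≤ 1 / nrm x ^ 2 * (1 / nrm x) := by gcongr
      _ = _ := by field_simp
  have f3 : C / s ^ 12 = C * (1 / nrm x ^ 3) := by
    rw [hxs, ← pow_mul]; ring
  have f1' : 0 ≤ a * (1 - Real.exp (-(2 * nrm x ^ 2 / M))) := by positivity
  have f2' : 0 ≤ a * Real.exp (-(2 * nrm x ^ 2 / s ^ 6)) := by positivity
  rw [f3] at h1
  have f4 : 0 ≤ 1 / nrm x ^ 3 := by positivity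
  have f5 : 0 ≤ C * (1 / M) := by positivity
  rw [abs_le] at h1 ⊢
  constructor <;> nlinarith

/-- The scale-invariant profile of `t * gauss t x`. -/
noncomputable def profile (s : ℝ) : ℝ := s⁻¹ * Real.exp (-(2 / s))

lemma pos_of_mem_uIcc {a b t : ℝ} (ha : 0 < a) (hb : 0 < b) (ht : t ∈ Set.uIcc a b) : 0 < t :=
  lt_of_lt_of_le (lt_min ha hb) ht.1

lemma continuousOn_profile {a b : ℝ} (ha : 0 < a) (hb : 0 < b) :
    ContinuousOn profile (Set.uIcc a b) := by
  have hne : ∀ t ∈ Set.uIcc a b, t ≠ 0 := fun t ht => (pos_of_mem_uIcc ha hb ht).ne'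
  exact (continuousOn_id.inv₀ hne).mul (continuousOn_const.div continuousOn_id hne).neg.rexp

lemma intervalIntegrable_profile {a b : ℝ} (ha : 0 < a) (hb : 0 < b) :
    IntervalIntegrable profile volume a b :=
  (continuousOn_profile ha hb).intervalIntegrable

lemma profile_le {s : ℝ} (hs : 0 < s) : profile s ≤ s := by
  have h := Real.quadratic_le_exp_of_nonneg (x := 2 / s) (by positivity)
  rw [profile, Real.exp_neg, ← mul_inv, inv_le_comm₀ (by positivity) hs]
  have h2 : (2 / s) ^ 2 / 2 = 2 * s⁻¹ * s⁻¹ := by field_simp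
  have h3 : 0 < 2 / s := by positivity
  have h4 : 2 * s⁻¹ * s⁻¹ ≤ Real.exp (2 / s) := by linarith
  calc s⁻¹ ≤ s * (2 * s⁻¹ * s⁻¹) := by
        field_simp
        norm_num
    _ ≤ _ := by gcongr

lemma integral_mul_gauss {T M : ℝ} {x : Fin 4 → ℤ} (hx : x ≠ 0) :
    ∫ t in T..M, t * gauss t x =
      4 / Real.pi ^ 2 * ∫ s in (T / nrm x ^ 2)..(M / nrm x ^ 2), profile s := by
  have hr : 0 < nrm x := by linarith [one_le_nrm hx]
  have hR : nrm x ^ 2 ≠ 0 := by positivity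
  have h := intervalIntegral.integral_comp_div (a := T) (b := M) profile hR
  rw [smul_eq_mul] at h
  rw [← mul_right_inj' hR, mul_left_comm, ← h, ← intervalIntegral.integral_const_mul,
    ← intervalIntegral.integral_const_mul]
  apply intervalIntegral.integral_congr
  intro t _
  simp only [gauss, profile]
  rcases eq_or_ne t 0 with rfl | ht
  · simp
  · have : 2 / (t / nrm x ^ 2) = 2 * nrm x ^ 2 / t := by field_simp
    rw [this]
    field_simp

lemma abs_integral_profile_le {a b : ℝ} (ha : 0 < a) (hb : 0 < b) :
    |∫ s in a..b, profile s| ≤ a ^ 2 + b ^ 2 := by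
  have hmax : max a b ^ 2 ≤ a ^ 2 + b ^ 2 := by
    rcases max_choice a b with h | h <;> rw [h] <;> nlinarith
  have h : ‖∫ s in a..b, profile s‖ ≤ max a b * |b - a| := by
    refine intervalIntegral.norm_integral_le_of_norm_le_const fun s hs => ?_
    have h0 := pos_of_mem_uIcc ha hb (Set.uIoc_subset_uIcc hs)
    rw [Real.norm_of_nonneg (by unfold profile; positivity)]
    exact (profile_le h0).trans hs.2
  refine h.trans (le_trans ?_ hmax)
  rw [sq]
  gcongr
  rw [abs_le]
  constructor <;> linarith [le_max_left a b, le_max_right a b]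

lemma abs_integral_profile_sub_log_le {a b : ℝ} (ha : 0 < a) (hb : 0 < b) :
    |(∫ s in a..b, profile s) - Real.log (b / a)| ≤ 2 * (1 / a + 1 / b) := by
  have hne : ∀ t ∈ Set.uIcc a b, t ≠ 0 := fun t ht => (pos_of_mem_uIcc ha hb ht).ne'
  have hi : IntervalIntegrable (fun s : ℝ => s⁻¹) volume a b :=
    (continuousOn_id.inv₀ hne).intervalIntegrable
  have hi2 : IntervalIntegrable (fun s : ℝ => 2 / s ^ 2) volume a b :=
    (continuousOn_const.div (by fun_prop) fun t ht => pow_ne_zero _ (hne t ht)).intervalIntegrable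
  rw [← integral_inv_of_pos ha hb,
    ← intervalIntegral.integral_sub (intervalIntegrable_profile ha hb) hi]
  have h : ‖∫ s in a..b, (profile s - s⁻¹)‖ ≤ |∫ s in a..b, 2 / s ^ 2| := by
    refine intervalIntegral.norm_integral_le_abs_of_norm_le ?_ hi2
    refine (ae_restrict_iff' measurableSet_uIoc).2 (Eventually.of_forall fun s hs => ?_)
    have h0 := pos_of_mem_uIcc ha hb (Set.uIoc_subset_uIcc hs)
    have h1 : Real.exp (-(2 / s)) ≤ 1 := by
      rw [Real.exp_le_one_iff, neg_nonpos]; positivity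
    have h2 := Real.add_one_le_exp (-(2 / s))
    rw [profile, show s⁻¹ * Real.exp (-(2 / s)) - s⁻¹ = -(s⁻¹ * (1 - Real.exp (-(2 / s)))) by ring,
      norm_neg, Real.norm_of_nonneg (mul_nonneg (by positivity) (by linarith))]
    calc _ ≤ s⁻¹ * (2 / s) := by gcongr; linarith
      _ = _ := by field_simp
  refine h.trans ?_
  have h2 := intervalIntegral.integral_eq_sub_of_hasDerivAt (a := a) (b := b)
    (f := fun t => -(2 * t⁻¹)) (f' := fun t => 2 / t ^ 2)
    (fun t ht => (((hasDerivAt_inv (hne t ht)).const_mul 2).neg).congr_deriv (by ring)) hi2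
  rw [h2, one_div, one_div]
  have h3 := inv_pos.2 ha
  have h4 := inv_pos.2 hb
  rw [abs_le]
  constructor <;> linarith

lemma abs_sub_sub_le_of_decomposition {b₁ b₂ κ I₁ I₂ I₃ l X Y Q C : ℝ} (hκ0 : 0 ≤ κ) (hκ1 : κ ≤ 1)
    (hC : 0 ≤ C) (hQ : 0 ≤ Q) (h1 : |b₁ - κ * (I₁ + I₂ + I₃)| ≤ C * X)
    (h2 : |b₂ - κ * I₂| ≤ C * Y) (h3 : |I₁| ≤ X + Y) (h4 : |I₃ - 2 * l| ≤ 2 * Q) :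
    |b₁ - b₂ - 2 * κ * l| ≤ (C + 2) * (X + Y + Q) := by
  have k1 : |κ * I₁| ≤ X + Y := by
    rw [abs_mul, abs_of_nonneg hκ0]
    exact (mul_le_of_le_one_left (abs_nonneg _) hκ1).trans h3
  have k3 : |κ * (I₃ - 2 * l)| ≤ 2 * Q := by
    rw [abs_mul, abs_of_nonneg hκ0]
    exact (mul_le_of_le_one_left (abs_nonneg _) hκ1).trans h4
  have k0 : 0 ≤ X + Y := (abs_nonneg _).trans h3
  have k5 : 0 ≤ C * Q := by positivity
  have hdec : b₁ - b₂ - 2 * κ * l =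
      (b₁ - κ * (I₁ + I₂ + I₃)) - (b₂ - κ * I₂) + κ * I₁ + κ * (I₃ - 2 * l) := by ring
  rw [hdec]
  rw [abs_le] at h1 h2 k1 k3 ⊢
  constructor <;> linarith [h1.1, h1.2, h2.1, h2.2, k1.1, k1.2, k3.1, k3.2]

lemma exists_abs_biharm_sub_le : ∃ C, 0 ≤ C ∧ ∀ (M : ℝ) (x y : Fin 4 → ℤ), x ≠ 0 → y ≠ 0 →
    nrm x ^ 2 ≤ M → nrm y ^ 2 ≤ M →
    |biharm M x - biharm M y - 8 / Real.pi ^ 2 * Real.log (nrm y / nrm x)| ≤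
      C * (1 / nrm x + 1 / nrm y + (nrm x ^ 2 + nrm y ^ 2) / M) := by
  obtain ⟨C, hC, h⟩ := exists_abs_integral_heat_sub_le
  refine ⟨C + 2, by positivity, fun M x y hx hy hxM hyM => ?_⟩
  obtain ⟨s, hs, hxs⟩ := exists_pow_four_eq_nrm hx
  obtain ⟨u, hu, hyu⟩ := exists_pow_four_eq_nrm hy
  have hs0 : 0 < s := by linarith
  have hu0 : 0 < u := by linarith
  have hx0 : 0 < nrm x := by rw [hxs]; positivity
  have hy0 : 0 < nrm y := by rw [hyu]; positivity
  have hTM : s ^ 6 ≤ M := by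
    refine le_trans ?_ hxM
    rw [hxs, ← pow_mul]
    exact pow_le_pow_right₀ hs (by norm_num)
  have hTM' : u ^ 6 ≤ M := by
    refine le_trans ?_ hyM
    rw [hyu, ← pow_mul]
    exact pow_le_pow_right₀ hu (by norm_num)
  have hM0 : 0 < M := lt_of_lt_of_le (by positivity) hTM
  have h1 := (h M s x hs hxs hTM).2
  have h2 := (h M u y hu hyu hTM').2
  rw [integral_mul_gauss hx] at h1
  rw [integral_mul_gauss hy] at h2
  have px : 0 < s ^ 6 / nrm x ^ 2 := by positivity
  have py : 0 < u ^ 6 / nrm y ^ 2 := by positivity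
  have qx : 0 < M / nrm x ^ 2 := by positivity
  have qy : 0 < M / nrm y ^ 2 := by positivity
  have hsplit : (∫ t in (s ^ 6 / nrm x ^ 2)..(M / nrm x ^ 2), profile t) =
      (∫ t in (s ^ 6 / nrm x ^ 2)..(u ^ 6 / nrm y ^ 2), profile t) +
      (∫ t in (u ^ 6 / nrm y ^ 2)..(M / nrm y ^ 2), profile t) +
      ∫ t in (M / nrm y ^ 2)..(M / nrm x ^ 2), profile t := by
    rw [intervalIntegral.integral_add_adjacent_intervals (intervalIntegrable_profile px py)
      (intervalIntegrable_profile py qy), intervalIntegral.integral_add_adjacent_intervals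
      (intervalIntegrable_profile px qy) (intervalIntegrable_profile qy qx)]
  have h3 := abs_integral_profile_le px py
  have h4 := abs_integral_profile_sub_log_le qy qx
  have hlog : Real.log (M / nrm x ^ 2 / (M / nrm y ^ 2)) = 2 * Real.log (nrm y / nrm x) := by
    rw [show M / nrm x ^ 2 / (M / nrm y ^ 2) = (nrm y / nrm x) ^ 2 by field_simp, Real.log_pow]
    norm_num
  rw [hlog] at h4
  have e1 : (s ^ 6 / nrm x ^ 2) ^ 2 = 1 / nrm x := by rw [hxs]; field_simp
  have e2 : (u ^ 6 / nrm y ^ 2) ^ 2 = 1 / nrm y := by rw [hyu]; field_simp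
  have e3 : 2 * (1 / (M / nrm y ^ 2) + 1 / (M / nrm x ^ 2)) =
      2 * ((nrm x ^ 2 + nrm y ^ 2) / M) := by field_simp; ring
  have e4 : C / s ^ 6 ≤ C * (1 / nrm x) := by
    rw [mul_one_div, hxs]
    gcongr
    norm_num
  have e5 : C / u ^ 6 ≤ C * (1 / nrm y) := by
    rw [mul_one_div, hyu]
    gcongr
    norm_num
  rw [e1, e2] at h3
  rw [e3] at h4
  have hpi := Real.pi_gt_three
  rw [hsplit] at h1
  rw [show 8 / Real.pi ^ 2 = 2 * (4 / Real.pi ^ 2) by ring]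
  refine abs_sub_sub_le_of_decomposition (by positivity) ?_ hC (by positivity) (h1.trans e4)
    (h2.trans e5) h3 h4
  rw [div_le_one (by positivity)]
  nlinarith

lemma avg_nrm_sq (x : Fin 4 → ℤ) : avg (fun z => nrm z ^ 2) x = nrm x ^ 2 + 1 := by
  rw [avg_eq]
  simp only [nrm_sq, Fin.sum_univ_four, Pi.add_apply, Pi.single_apply]
  simp
  ring

lemma avg_mono {f g : (Fin 4 → ℤ) → ℝ} {x : Fin 4 → ℤ}
    (h : ∀ e ∈ steps 4, f (x + e) ≤ g (x + e)) :
    avg f x ≤ avg g x :=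
  mul_le_mul_of_nonneg_left (Finset.sum_le_sum h) (by norm_num)

lemma avg_sum {ι : Type*} (s : Finset ι) (f : ι → (Fin 4 → ℤ) → ℝ) (x : Fin 4 → ℤ) :
    avg (fun z => ∑ j ∈ s, f j z) x = ∑ j ∈ s, avg (f j) x := by
  simp only [avg]
  rw [Finset.sum_comm, Finset.mul_sum]

lemma avg_mul_const (f : (Fin 4 → ℤ) → ℝ) (c : ℝ) (x : Fin 4 → ℤ) :
    avg (fun z => f z * c) x = avg f x * c := by
  simp only [avg, ← Finset.sum_mul, mul_assoc]

lemma nrm_add_le_of_mem_steps {N : ℝ} {x e : Fin 4 → ℤ} (hx : nrm x ≤ N) (he : e ∈ steps 4) :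
    nrm (x + e) ≤ N + 1 := by
  have := nrm_add_le x e
  rw [nrm_of_mem_steps he] at this
  linarith

lemma finite_setOf_nrm_le (N : ℝ) : {z : Fin 4 → ℤ | nrm z ≤ N}.Finite := by
  refine (Set.finite_Icc (fun _ : Fin 4 => -⌈N⌉) (fun _ => ⌈N⌉)).subset fun z hz => ?_
  have hz' : nrm z ≤ N := hz
  have key : ∀ i, |(z i : ℝ)| ≤ ⌈N⌉ := fun i => by
    refine le_trans ?_ (hz'.trans (Int.le_ceil N))
    refine abs_le_of_sq_le_sq ?_ (nrm_nonneg z)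
    rw [nrm_sq]
    exact Finset.single_le_sum (f := fun i => (z i : ℝ) ^ 2) (fun i _ => sq_nonneg _)
      (Finset.mem_univ i)
  refine ⟨fun i => ?_, fun i => ?_⟩
  · have := (abs_le.1 (key i)).1
    exact_mod_cast this
  · have := (abs_le.1 (key i)).2
    exact_mod_cast this

/-- The expected exit time of the ball of radius `N` is bounded by this function. -/
noncomputable def barrier (N : ℝ) (x : Fin 4 → ℤ) : ℝ := (N + 1) ^ 2 - nrm x ^ 2

lemma avg_barrier (N : ℝ) (x : Fin 4 → ℤ) : avg (barrier N) x = barrier N x - 1 := by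
  have := avg_sub (fun _ => (N + 1) ^ 2) (fun z => nrm z ^ 2) x
  rw [avg_const, avg_nrm_sq] at this
  unfold barrier
  rw [this]
  ring

lemma barrier_nonneg {N : ℝ} {x : Fin 4 → ℤ} (hx : nrm x ≤ N + 1) : 0 ≤ barrier N x :=
  sub_nonneg.2 (pow_le_pow_left₀ (nrm_nonneg x) hx 2)

lemma barrier_le (N : ℝ) (x : Fin 4 → ℤ) : barrier N x ≤ (N + 1) ^ 2 :=
  sub_le_self _ (sq_nonneg _)

lemma le_of_sub_avg_lt {N B ε : ℝ} {φ : (Fin 4 → ℤ) → ℝ} (hε : 0 ≤ ε)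
    (h : ∀ x, nrm x ≤ N → φ x - avg φ x < ε)
    (hB : ∀ x, N < nrm x → nrm x ≤ N + 1 → φ x ≤ B) {x : Fin 4 → ℤ} (hx : nrm x ≤ N) :
    φ x ≤ B + ε * barrier N x := by
  have hx' : nrm x ≤ N + 1 := by linarith
  obtain ⟨m, hm, hmax⟩ := Set.exists_max_image _ (fun z => φ z - ε * barrier N z)
    (finite_setOf_nrm_le (N + 1)) ⟨x, hx'⟩
  have hm' : nrm m ≤ N + 1 := hm
  have hxm := hmax x hx'
  suffices hmN : N < nrm m by
    have h1 := hB m hmN hm'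
    have h2 := mul_nonneg hε (barrier_nonneg hm')
    linarith
  by_contra! hmN
  have h1 := avg_mono (f := fun z => φ z - ε * barrier N z)
    (g := fun _ => φ m - ε * barrier N m) (x := m)
    fun e he => hmax _ (nrm_add_le_of_mem_steps hmN he)
  rw [avg_const, avg_sub, avg_const_mul, avg_barrier] at h1
  linarith [h m hmN]

lemma le_of_sub_avg_le {N B ε : ℝ} {φ : (Fin 4 → ℤ) → ℝ} (hε : 0 ≤ ε)
    (h : ∀ x, nrm x ≤ N → φ x - avg φ x ≤ ε)
    (hB : ∀ x, N < nrm x → nrm x ≤ N + 1 → φ x ≤ B) {x : Fin 4 → ℤ} (hx : nrm x ≤ N) :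
    φ x ≤ B + ε * barrier N x := by
  have hb : 0 ≤ barrier N x := barrier_nonneg (by linarith)
  refine le_of_forall_pos_le_add fun δ hδ => ?_
  have h1 := le_of_sub_avg_lt (N := N) (B := B) (ε := ε + δ / (barrier N x + 1)) (φ := φ)
    (by positivity) (fun z hz => (h z hz).trans_lt (lt_add_of_pos_right _ (by positivity))) hB hx
  have h2 : δ / (barrier N x + 1) * barrier N x ≤ δ := by
    rw [div_mul_eq_mul_div, div_le_iff₀ (by positivity)]
    nlinarith
  linarith

lemma abs_le_of_abs_sub_avg_le {N B ε : ℝ} {φ : (Fin 4 → ℤ) → ℝ} (hε : 0 ≤ ε)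
    (h : ∀ x, nrm x ≤ N → |φ x - avg φ x| ≤ ε)
    (hB : ∀ x, N < nrm x → nrm x ≤ N + 1 → |φ x| ≤ B) {x : Fin 4 → ℤ} (hx : nrm x ≤ N) :
    |φ x| ≤ B + ε * (N + 1) ^ 2 := by
  have hb := mul_le_mul_of_nonneg_left (barrier_le N x) hε
  have h1 := le_of_sub_avg_le hε (fun z hz => (abs_le.1 (h z hz)).2)
    (fun z hz hz' => (abs_le.1 (hB z hz hz')).2) hx
  have h2 := le_of_sub_avg_le (φ := fun z => (-1) * φ z) (B := B) hε
    (fun z hz => by rw [avg_const_mul]; linarith [(abs_le.1 (h z hz)).1])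
    (fun z hz hz' => by linarith [(abs_le.1 (hB z hz hz')).1]) hx
  rw [abs_le]
  constructor <;> linarith

lemma transK_succ (N : ℝ) (j : ℕ) (x y : Fin 4 → ℤ) :
    transK 4 N (j + 1) x y = if nrm x ≤ N then avg (fun z => transK 4 N j z y) x else 0 := rfl

lemma transK_nonneg (N : ℝ) (j : ℕ) (x y : Fin 4 → ℤ) : 0 ≤ transK 4 N j x y := by
  induction j generalizing x with
  | zero => simp only [transK]; split_ifs <;> norm_num
  | succ j ih =>
    rw [transK_succ]
    split_ifs
    · exact mul_nonneg (by norm_num) (Finset.sum_nonneg fun e _ => ih _)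
    · exact le_rfl

lemma transK_eq_zero_of_lt_left {N : ℝ} {x : Fin 4 → ℤ} (hx : N < nrm x) (j : ℕ)
    (y : Fin 4 → ℤ) : transK 4 N j x y = 0 := by
  cases j with
  | zero => simp [transK, hx]
  | succ j => rw [transK_succ, if_neg hx.not_ge]

lemma sum_range_transK_le (N : ℝ) (y : Fin 4 → ℤ) (J : ℕ) {x : Fin 4 → ℤ} (hx : nrm x ≤ N + 1) :
    ∑ j ∈ Finset.range J, transK 4 N j x y ≤ barrier N x := by
  induction J generalizing x with
  | zero => simpa using barrier_nonneg hx
  | succ J ih =>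
    by_cases hxN : nrm x ≤ N
    · rw [Finset.sum_range_succ']
      simp only [transK_succ, if_pos hxN]
      rw [← avg_sum]
      have h0 : transK 4 N 0 x y ≤ 1 := by simp only [transK]; split_ifs <;> norm_num
      have h1 := avg_mono (f := fun z => ∑ j ∈ Finset.range J, transK 4 N j z y)
        (g := barrier N) (x := x) fun e he => ih (nrm_add_le_of_mem_steps hxN he)
      rw [avg_barrier] at h1
      linarith
    · rw [Finset.sum_eq_zero fun j _ => transK_eq_zero_of_lt_left (not_le.1 hxN) j y]
      exact barrier_nonneg hx

lemma summable_transK (N : ℝ) (x y : Fin 4 → ℤ) : Summable fun j => transK 4 N j x y := by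
  by_cases hx : nrm x ≤ N
  · exact summable_of_sum_range_le (fun j => transK_nonneg N j x y)
      fun J => sum_range_transK_le N y J (by linarith)
  · simpa only [transK_eq_zero_of_lt_left (not_le.1 hx)] using summable_zero

lemma GN_eq_zero_of_lt {N : ℝ} {x : Fin 4 → ℤ} (hx : N < nrm x) (y : Fin 4 → ℤ) :
    GN 4 N x y = 0 := by
  simp only [GN, transK_eq_zero_of_lt_left hx, tsum_zero]

lemma GN_eq {N : ℝ} {x : Fin 4 → ℤ} (hx : nrm x ≤ N) (y : Fin 4 → ℤ) :
    GN 4 N x y = (if x = y then 1 else 0) + avg (fun z => GN 4 N z y) x := by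
  rw [GN, (summable_transK N x y).tsum_eq_zero_add]
  congr 1
  · simp [transK, hx]
  · simp only [transK_succ, if_pos hx, avg, GN]
    rw [tsum_mul_left, Summable.tsum_finsetSum fun e _ => summable_transK N (x + e) y]

lemma GN2_eq_sum (N : ℝ) (x y : Fin 4 → ℤ) :
    GN2 4 N x y = ∑ z ∈ (finite_setOf_nrm_le N).toFinset, GN 4 N x z * GN 4 N z y := by
  refine tsum_eq_sum fun z hz => ?_
  rw [GN_eq_zero_of_lt (x := z) (by simpa using hz), mul_zero]

lemma GN2_eq_zero_of_lt {N : ℝ} {x : Fin 4 → ℤ} (hx : N < nrm x) (y : Fin 4 → ℤ) :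
    GN2 4 N x y = 0 := by
  simp only [GN2, GN_eq_zero_of_lt hx, zero_mul, tsum_zero]

lemma GN2_eq {N : ℝ} {x : Fin 4 → ℤ} (hx : nrm x ≤ N) (y : Fin 4 → ℤ) :
    GN2 4 N x y = GN 4 N x y + avg (fun z => GN2 4 N z y) x := by
  simp only [GN2_eq_sum, avg_sum, avg_mul_const]
  rw [Finset.sum_congr rfl fun z _ => by rw [GN_eq hx z, add_mul], Finset.sum_add_distrib]
  congr 1
  simp [hx]

lemma sub_nrm_bounds_of_boundary {N : ℝ} {y z : Fin 4 → ℤ} (hy : nrm y ≤ N / 2) (hz : N < nrm z)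
    (hz' : nrm z ≤ N + 1) :
    N / 2 ≤ nrm (z - y) ∧ |nrm (z - y) - N| ≤ nrm y + 1 := by
  have h1 := le_nrm_sub z y
  have h2 := nrm_sub_le z y
  refine ⟨by linarith, abs_le.2 ⟨by linarith, by linarith⟩⟩

lemma ne_zero_of_nrm_pos {x : Fin 4 → ℤ} (hx : 0 < nrm x) : x ≠ 0 := by
  rintro rfl
  simp [nrm] at hx

lemma two_div_pi_sq_le_one : 2 / Real.pi ^ 2 ≤ 1 := by
  rw [div_le_one (by positivity)]
  nlinarith [Real.pi_gt_three]

lemma abs_div_sq_sub_div_sq_le {a N r p : ℝ} (ha : 0 ≤ a) (ha1 : a ≤ 1) (hN : 0 < N)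
    (hr : N / 2 ≤ r) (hr' : r ≤ 2 * N) (h : |r - N| ≤ p) :
    |a / r ^ 2 - a / N ^ 2| ≤ 12 * p / N ^ 3 := by
  have hr0 : 0 < r := by linarith
  have e : a / r ^ 2 - a / N ^ 2 = a * ((N + r) / (r ^ 2 * N ^ 2)) * -(r - N) := by
    field_simp
    ring
  rw [e, abs_mul, abs_neg, abs_of_nonneg (by positivity)]
  have h1 : (N + r) / (r ^ 2 * N ^ 2) ≤ 12 / N ^ 3 := by
    calc (N + r) / (r ^ 2 * N ^ 2) ≤ (N + 2 * N) / ((N / 2) ^ 2 * N ^ 2) := by gcongr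
      _ = _ := by field_simp; norm_num
  calc a * ((N + r) / (r ^ 2 * N ^ 2)) * |r - N| ≤ 1 * (12 / N ^ 3) * p := by gcongr
    _ = _ := by ring

lemma abs_log_div_le {N r p : ℝ} (hN : 0 < N) (hr : N / 2 ≤ r) (h : |r - N| ≤ p) :
    |Real.log (N / r)| ≤ 2 * p / N := by
  have hr0 : 0 < r := by linarith
  have h1 := Real.log_le_sub_one_of_pos (div_pos hN hr0)
  have h2 := Real.log_le_sub_one_of_pos (div_pos hr0 hN)
  have h3 : Real.log (r / N) = -Real.log (N / r) := by rw [← Real.log_inv, inv_div]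
  rw [abs_le] at h
  have hp : 0 ≤ p := by linarith
  have h4 : N / r - 1 ≤ 2 * p / N := by
    rw [div_sub_one hr0.ne', div_le_div_iff₀ hr0 hN]
    nlinarith
  have h5 : r / N - 1 ≤ 2 * p / N := by
    rw [div_sub_one hN.ne']
    gcongr
    linarith
  rw [abs_le]
  constructor <;> linarith

lemma add_one_sq_le {N : ℝ} (hN : 1 ≤ N) : (N + 1) ^ 2 ≤ 4 * N ^ 2 := by nlinarith

lemma exists_abs_GN_sub_green_le : ∃ C, 0 ≤ C ∧ ∀ (N : ℝ) (x y : Fin 4 → ℤ), 2 ≤ N →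
    nrm y ≤ N / 2 → nrm x ≤ N →
    |GN 4 N x y - green (N ^ 4) (x - y) + 2 / Real.pi ^ 2 / N ^ 2| ≤
      C * (nrm y + 1) / N ^ 3 := by
  obtain ⟨C₁, hC₁, h₁⟩ := exists_abs_green_sub_le
  obtain ⟨C₂, hC₂, h₂⟩ := exists_abs_heat_le
  refine ⟨9 * C₁ + 12 + 4 * C₂, by positivity, fun N x y hN hy hx => ?_⟩
  have hN0 : 0 < N := by linarith
  have hq := nrm_nonneg y
  refine (abs_le_of_abs_sub_avg_le (N := N) (B := (9 * C₁ + 12) * (nrm y + 1) / N ^ 3)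
    (ε := C₂ / (N ^ 4) ^ 2)
    (φ := fun z => GN 4 N z y - green (N ^ 4) (z - y) + 2 / Real.pi ^ 2 / N ^ 2)
    (by positivity) (fun z hz => ?_) (fun z hz hz' => ?_) hx).trans ?_
  · rw [avg_add (fun z => GN 4 N z y - green (N ^ 4) (z - y)), avg_const, avg_sub, avg_comp_sub]
    have h := green_sub_avg (N ^ 4) (z - y)
    have h' := GN_eq hz y
    simp only [sub_eq_zero] at h
    refine le_trans (le_of_eq ?_) (h₂ (N ^ 4) (one_le_pow₀ (by linarith)) (z - y))
    congr 1
    linarith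
  · obtain ⟨hr, hrN⟩ := sub_nrm_bounds_of_boundary hy hz hz'
    have hr0 : 0 < nrm (z - y) := by linarith
    have hr' : nrm (z - y) ≤ 2 * N := by linarith [(abs_le.1 hrN).2]
    have hM : nrm (z - y) ^ 2 ≤ N ^ 4 := by
      calc nrm (z - y) ^ 2 ≤ (2 * N) ^ 2 := by gcongr
        _ ≤ (N * N) ^ 2 := by gcongr
        _ = _ := by ring
    have hg := h₁ (N ^ 4) (z - y) (ne_zero_of_nrm_pos hr0) hM
    have hd := abs_div_sq_sub_div_sq_le (by positivity) two_div_pi_sq_le_one hN0 hr hr' hrN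
    have hg' : C₁ * (1 / nrm (z - y) ^ 3 + 1 / N ^ 4) ≤ 9 * C₁ * (nrm y + 1) / N ^ 3 := by
      calc C₁ * (1 / nrm (z - y) ^ 3 + 1 / N ^ 4)
          ≤ C₁ * (1 / (N / 2) ^ 3 + 1 / N ^ 3) := by
            gcongr
            · linarith
            · norm_num
        _ = 9 * C₁ * 1 / N ^ 3 := by field_simp; norm_num
        _ ≤ _ := by gcongr; linarith
    have hs : (9 * C₁ + 12) * (nrm y + 1) / N ^ 3 =
        9 * C₁ * (nrm y + 1) / N ^ 3 + 12 * (nrm y + 1) / N ^ 3 := by ring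
    rw [GN_eq_zero_of_lt hz, hs]
    rw [abs_le] at hg hd ⊢
    constructor <;> linarith [hg.1, hg.2, hd.1, hd.2]
  · have h : C₂ / (N ^ 4) ^ 2 * (N + 1) ^ 2 ≤ 4 * C₂ * (nrm y + 1) / N ^ 3 := by
      calc C₂ / (N ^ 4) ^ 2 * (N + 1) ^ 2 ≤ C₂ / (N ^ 4) ^ 2 * (4 * N ^ 2) := by
            gcongr; exact add_one_sq_le (by linarith)
        _ = 4 * C₂ * 1 / N ^ 6 := by field_simp
        _ ≤ 4 * C₂ * (nrm y + 1) / N ^ 3 := by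
            gcongr
            · linarith
            · linarith
            · norm_num
    calc _ ≤ (9 * C₁ + 12) * (nrm y + 1) / N ^ 3 + 4 * C₂ * (nrm y + 1) / N ^ 3 := by gcongr
      _ = _ := by ring

lemma exists_abs_biharm_sub_log_le : ∃ C, 0 ≤ C ∧ ∀ (N : ℝ) (x z₀ : Fin 4 → ℤ), 2 ≤ N →
    nrm z₀ = N → x ≠ 0 → nrm x ≤ 2 * N →
    |biharm (N ^ 4) x - biharm (N ^ 4) z₀ - 8 / Real.pi ^ 2 * Real.log (N / nrm x)| ≤
      C * (1 / nrm x + 1 / N) := by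
  obtain ⟨C, hC, h⟩ := exists_abs_biharm_sub_le
  refine ⟨6 * C, by positivity, fun N x z₀ hN hz₀ hx hxN => ?_⟩
  have hN0 : 0 < N := by linarith
  have hx0 : 0 < nrm x := by linarith [one_le_nrm hx]
  have hM : (2 * N) ^ 2 ≤ N ^ 4 := by
    calc (2 * N) ^ 2 ≤ (N * N) ^ 2 := by gcongr
      _ = _ := by ring
  have h1 := h (N ^ 4) x z₀ hx (ne_zero_of_nrm_pos (by linarith))
    (le_trans (by gcongr) hM) (le_trans (by rw [hz₀]; gcongr; linarith) hM)
  rw [hz₀] at h1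
  refine h1.trans ?_
  have h2 : (nrm x ^ 2 + N ^ 2) / N ^ 4 ≤ 5 / N := by
    calc (nrm x ^ 2 + N ^ 2) / N ^ 4 ≤ ((2 * N) ^ 2 + N ^ 2) / N ^ 4 := by gcongr
      _ = 5 / N ^ 2 := by field_simp; norm_num
      _ ≤ 5 / N := by gcongr; nlinarith
  have h3 : 0 < 1 / nrm x := by positivity
  calc C * (1 / nrm x + 1 / N + (nrm x ^ 2 + N ^ 2) / N ^ 4)
      ≤ C * (6 * (1 / nrm x) + 1 / N + 5 / N) := by gcongr; linarith
    _ = _ := by ring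

lemma exists_abs_GN2_sub_le : ∃ C, 0 ≤ C ∧ ∀ (N : ℝ) (x y z₀ : Fin 4 → ℤ), 2 ≤ N →
    nrm z₀ = N → nrm y ≤ N / 2 → nrm x ≤ N →
    |GN2 4 N x y - (biharm (N ^ 4) (x - y) - biharm (N ^ 4) z₀ -
      2 / Real.pi ^ 2 / N ^ 2 * (N ^ 2 - nrm x ^ 2))| ≤ C * (nrm y + 1) / N := by
  obtain ⟨C₁, hC₁, h₁⟩ := exists_abs_GN_sub_green_le
  obtain ⟨C₂, hC₂, h₂⟩ := exists_abs_heat_le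
  obtain ⟨C₃, hC₃, h₃⟩ := exists_abs_biharm_sub_log_le
  refine ⟨3 * C₃ + 11 + 4 * (C₁ + C₂), by positivity, fun N x y z₀ hN hz₀ hy hx => ?_⟩
  have hN0 : 0 < N := by linarith
  have hq := nrm_nonneg y
  refine (abs_le_of_abs_sub_avg_le (N := N) (B := (3 * C₃ + 11) * (nrm y + 1) / N)
    (ε := (C₁ + C₂) * (nrm y + 1) / N ^ 3)
    (φ := fun z => GN2 4 N z y - (biharm (N ^ 4) (z - y) - biharm (N ^ 4) z₀ -
      2 / Real.pi ^ 2 / N ^ 2 * (N ^ 2 - nrm z ^ 2)))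
    (by positivity) (fun z hz => ?_) (fun z hz hz' => ?_) hx).trans ?_
  · rw [avg_sub, avg_sub, avg_sub, avg_const, avg_const_mul, avg_sub, avg_const, avg_nrm_sq,
      avg_comp_sub]
    have h := biharm_sub_avg (N ^ 4) (z - y)
    have h' := GN2_eq hz y
    have hG := h₁ N z y hN hy hz
    have hH := h₂ (N ^ 4) (one_le_pow₀ (by linarith)) (z - y)
    have hH' : |N ^ 4 * heat (N ^ 4) (z - y)| ≤ C₂ * (nrm y + 1) / N ^ 3 := by
      rw [abs_mul, abs_of_nonneg (by positivity)]
      calc N ^ 4 * |heat (N ^ 4) (z - y)| ≤ N ^ 4 * (C₂ / (N ^ 4) ^ 2) := by gcongr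
        _ = C₂ * 1 / N ^ 4 := by field_simp
        _ ≤ C₂ * (nrm y + 1) / N ^ 3 := by
          gcongr
          · linarith
          · linarith
          · norm_num
    have hs : (C₁ + C₂) * (nrm y + 1) / N ^ 3 =
        C₁ * (nrm y + 1) / N ^ 3 + C₂ * (nrm y + 1) / N ^ 3 := by ring
    rw [hs]
    refine le_trans (le_of_eq ?_) ((abs_add_le _ _).trans (add_le_add hG hH'))
    congr 1
    linear_combination h' - h
  · obtain ⟨hr, hrN⟩ := sub_nrm_bounds_of_boundary hy hz hz'
    have hr0 : 0 < nrm (z - y) := by linarith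
    have hr' : nrm (z - y) ≤ 2 * N := by linarith [(abs_le.1 hrN).2]
    have hb := h₃ N (z - y) z₀ hN hz₀ (ne_zero_of_nrm_pos hr0) hr'
    have hb' : C₃ * (1 / nrm (z - y) + 1 / N) ≤ 3 * C₃ * (nrm y + 1) / N := by
      calc C₃ * (1 / nrm (z - y) + 1 / N) ≤ C₃ * (1 / (N / 2) + 1 / N) := by gcongr
        _ = 3 * C₃ * 1 / N := by field_simp; norm_num
        _ ≤ _ := by gcongr; linarith
    have hl : |8 / Real.pi ^ 2 * Real.log (N / nrm (z - y))| ≤ 8 * (nrm y + 1) / N := by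
      rw [abs_mul, abs_of_nonneg (by positivity)]
      calc 8 / Real.pi ^ 2 * |Real.log (N / nrm (z - y))|
          = 4 * (2 / Real.pi ^ 2) * |Real.log (N / nrm (z - y))| := by ring
        _ ≤ 4 * 1 * (2 * (nrm y + 1) / N) := by
            gcongr
            · exact two_div_pi_sq_le_one
            · exact abs_log_div_le hN0 hr hrN
        _ = _ := by ring
    have hw : |2 / Real.pi ^ 2 / N ^ 2 * (N ^ 2 - nrm z ^ 2)| ≤ 3 * (nrm y + 1) / N := by
      rw [abs_mul, abs_of_nonneg (by positivity)]
      have : |N ^ 2 - nrm z ^ 2| ≤ 3 * N := by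
        rw [abs_le]
        constructor <;> nlinarith
      calc 2 / Real.pi ^ 2 / N ^ 2 * |N ^ 2 - nrm z ^ 2| ≤ 1 / N ^ 2 * (3 * N) := by
            gcongr
            exact two_div_pi_sq_le_one
        _ = 3 * 1 / N := by field_simp
        _ ≤ _ := by gcongr; linarith
    have hs : (3 * C₃ + 11) * (nrm y + 1) / N =
        3 * C₃ * (nrm y + 1) / N + 8 * (nrm y + 1) / N + 3 * (nrm y + 1) / N := by ring
    rw [GN2_eq_zero_of_lt hz, hs]
    rw [abs_le] at hb hl hw ⊢
    constructor <;> linarith [hb.1, hb.2, hl.1, hl.2, hw.1, hw.2]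
  · have h : (C₁ + C₂) * (nrm y + 1) / N ^ 3 * (N + 1) ^ 2 ≤
        4 * (C₁ + C₂) * (nrm y + 1) / N := by
      calc (C₁ + C₂) * (nrm y + 1) / N ^ 3 * (N + 1) ^ 2
          ≤ (C₁ + C₂) * (nrm y + 1) / N ^ 3 * (4 * N ^ 2) := by
            gcongr; exact add_one_sq_le (by linarith)
        _ = _ := by field_simp
    calc _ ≤ (3 * C₃ + 11) * (nrm y + 1) / N + 4 * (C₁ + C₂) * (nrm y + 1) / N := by gcongr
      _ = _ := by ring

theorem statement6 :
    ∃ c₀ : ℝ, ∃ C : ℝ, ∀ N : ℕ, ∀ x y : Fin 4 → ℤ, x ≠ y →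
      nrm x ≤ N / 2 → nrm y ≤ N / 2 → nrm (x - y) ≤ N / 2 →
      |GN2 4 N x y - (8 / Real.pi ^ 2) * Real.log (N / nrm (x - y)) - c₀| ≤
        C * ((nrm x + nrm y + 1) / N + 1 / nrm (x - y)) := by
  obtain ⟨C₁, hC₁, h₁⟩ := exists_abs_GN2_sub_le
  obtain ⟨C₂, hC₂, h₂⟩ := exists_abs_biharm_sub_log_le
  refine ⟨-(2 / Real.pi ^ 2), C₁ + C₂ + 1, fun N x y hxy hx hy hd => ?_⟩
  have hxy' : x - y ≠ 0 := sub_ne_zero.2 hxy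
  have hρ := one_le_nrm hxy'
  have hN : (2 : ℝ) ≤ N := by linarith
  have hN0 : (0 : ℝ) < N := by linarith
  have hz₀ : nrm (Pi.single 0 (N : ℤ) : Fin 4 → ℤ) = N := by
    simp [nrm, Pi.single_apply, Real.sqrt_sq hN0.le]
  have k₁ := h₁ N x y _ hN hz₀ hy (by linarith)
  have k₂ := h₂ N (x - y) _ hN hz₀ hxy' (by linarith)
  have hx0 := nrm_nonneg x
  have hy0 := nrm_nonneg y
  have k₃ : |2 / Real.pi ^ 2 / (N : ℝ) ^ 2 * nrm x ^ 2| ≤ nrm x / N := by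
    rw [abs_of_nonneg (by positivity)]
    calc 2 / Real.pi ^ 2 / (N : ℝ) ^ 2 * nrm x ^ 2
        ≤ 1 / (N : ℝ) ^ 2 * (nrm x * N) := by
          rw [sq (nrm x)]
          gcongr
          · exact two_div_pi_sq_le_one
          · linarith
      _ = _ := by field_simp
  have hdec : GN2 4 N x y - 8 / Real.pi ^ 2 * Real.log (N / nrm (x - y)) - -(2 / Real.pi ^ 2) =
      (GN2 4 N x y - (biharm ((N : ℝ) ^ 4) (x - y) -
        biharm ((N : ℝ) ^ 4) (Pi.single 0 (N : ℤ)) -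
        2 / Real.pi ^ 2 / (N : ℝ) ^ 2 * ((N : ℝ) ^ 2 - nrm x ^ 2))) +
      (biharm ((N : ℝ) ^ 4) (x - y) - biharm ((N : ℝ) ^ 4) (Pi.single 0 (N : ℤ)) -
        8 / Real.pi ^ 2 * Real.log (N / nrm (x - y))) +
      2 / Real.pi ^ 2 / (N : ℝ) ^ 2 * nrm x ^ 2 := by
    field_simp
    ring
  rw [hdec]
  refine (abs_add_three _ _ _).trans ((add_le_add (add_le_add k₁ k₂) k₃).trans ?_)
  have e₁ : C₁ * (nrm y + 1) / N ≤ C₁ * ((nrm x + nrm y + 1) / N) := by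
    rw [mul_div_assoc]
    gcongr
    linarith
  have e₂ : 1 / (N : ℝ) ≤ (nrm x + nrm y + 1) / N := by
    gcongr
    linarith
  have e₃ : nrm x / N ≤ (nrm x + nrm y + 1) / N := by
    gcongr
    linarith
  have e₄ : 0 ≤ 1 / nrm (x - y) := by positivity
  have e₅ := mul_le_mul_of_nonneg_left e₂ hC₂
  have e₆ := mul_nonneg hC₁ e₄
  linarith

end GreenFn
end

section
/- Suppose β > 0 and (p_n)_{n≥1} is a sequence of positive real numbers with p_{n+1}/p_n → 1 and such that the limit lim_{n→∞} [log p_n + β·Σ_{j=1}^n p_j] exists and is finite. Then lim_{n→∞} n·p_n = 1/β. -/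
open Filter Topology

/-- If `(p_n)` is a sequence of positive reals with `p_{n+1}/p_n → 1` such that
`log p_n + β Σ_{j=1}^n p_j` converges to a finite limit, then `n p_n → 1/β`. -/
theorem statement18 (β : ℝ) (hβ : 0 < β) (p : ℕ → ℝ)
    (hp : ∀ n, 1 ≤ n → 0 < p n)
    (hratio : Tendsto (fun n : ℕ => p (n + 1) / p n) atTop (𝓝 1))
    (L : ℝ)
    (hlim : Tendsto
      (fun n : ℕ => Real.log (p n) + β * ∑ j ∈ Finset.Icc 1 n, p j)
      atTop (𝓝 L)) :
    Tendsto (fun n : ℕ => (n : ℝ) * p n) atTop (𝓝 (1 / β)) := by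
  set S : ℕ → ℝ := fun n => ∑ j ∈ Finset.Icc 1 n, p j with hS
  have hsucc (n : ℕ) : S (n + 1) = S n + p (n + 1) :=
    Finset.sum_Icc_succ_top (by lia) p
  have hmono : Monotone S :=
    monotone_nat_of_le_succ fun n => by
      rw [hsucc]
      linarith [hp (n + 1) (by lia)]
  have hexp : ∀ᶠ n in atTop, Real.exp (Real.log (p n)) = p n := by
    filter_upwards [eventually_ge_atTop 1] with n hn using Real.exp_log (hp n hn)
  have hS_top : Tendsto S atTop atTop := by
    refine (tendsto_atTop_of_monotone hmono).resolve_right ?_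
    rintro ⟨s, hs⟩
    have hlog : Tendsto (fun n => Real.log (p n)) atTop (𝓝 (L - β * s)) :=
      (hlim.sub (hs.const_mul β)).congr fun n => by simp [hS]
    have hpos : Tendsto p atTop (𝓝 (Real.exp (L - β * s))) :=
      ((Real.continuous_exp.tendsto _).comp hlog).congr' hexp
    have hzero : Tendsto (fun n => p (n + 1)) atTop (𝓝 0) := by
      have h := (hs.comp (tendsto_add_atTop_nat 1)).sub hs
      rw [sub_self] at h
      exact h.congr fun n => by simp [hsucc]
    exact (Real.exp_pos _).ne'
      (tendsto_nhds_unique (hpos.comp (tendsto_add_atTop_nat 1)) hzero)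
  have hlog : Tendsto (fun n => Real.log (p n)) atTop atBot := by
    have h := hlim.add_atBot (tendsto_neg_atTop_atBot.comp (hS_top.const_mul_atTop hβ))
    exact h.congr fun n => by simp [hS]
  have hp_zero : Tendsto p atTop (𝓝 0) :=
    (Real.tendsto_exp_atBot.comp hlog).congr' hexp
  set E : ℕ → ℝ := fun n => Real.exp (β * S n) with hE
  have hpE : Tendsto (fun n => p n * E n) atTop (𝓝 (Real.exp L)) := by
    refine ((Real.continuous_exp.tendsto _).comp hlim).congr' ?_
    filter_upwards [hexp] with n hn
    simp only [Function.comp_apply, Real.exp_add, hn, hE, hS]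
  have hslope : Tendsto (fun x : ℝ => x⁻¹ * (1 - Real.exp (-(β * x)))) (𝓝[≠] 0) (𝓝 β) := by
    have hd : HasDerivAt (fun x : ℝ => 1 - Real.exp (-(β * x))) β 0 := by
      simpa using ((((hasDerivAt_id (0 : ℝ)).const_mul β).neg).exp).const_sub 1
    simpa using hasDerivAt_iff_tendsto_slope_zero.mp hd
  have hp_ne : Tendsto p atTop (𝓝[≠] 0) :=
    tendsto_nhdsWithin_iff.mpr ⟨hp_zero, by
      filter_upwards [eventually_ge_atTop 1] with n hn using (hp n hn).ne'⟩
  have hdiff : Tendsto (fun n => E (n + 1) - E n) atTop (𝓝 (Real.exp L * β)) := by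
    refine ((hpE.mul (hslope.comp hp_ne)).comp (tendsto_add_atTop_nat 1)).congr fun n => ?_
    have hpn := (hp (n + 1) (by lia)).ne'
    have hEn : E n = E (n + 1) * Real.exp (-(β * p (n + 1))) := by
      simp only [hE, ← Real.exp_add, hsucc]
      ring_nf
    simp only [Function.comp_apply]
    rw [hEn]
    field_simp
  have hces : Tendsto (fun n : ℕ => (n : ℝ)⁻¹ * E n) atTop (𝓝 (Real.exp L * β)) := by
    have h := hdiff.cesaro.add
      ((tendsto_inv_atTop_nhds_zero_nat (𝕜 := ℝ)).mul_const (E 0))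
    rw [zero_mul, add_zero] at h
    refine h.congr fun n => ?_
    rw [Finset.sum_range_sub]
    ring
  have hL := (Real.exp_pos L).ne'
  have hfinal := hpE.div hces (mul_ne_zero hL hβ.ne')
  rw [show Real.exp L / (Real.exp L * β) = 1 / β by field_simp] at hfinal
  refine hfinal.congr' ?_
  filter_upwards [eventually_ge_atTop 1] with n hn
  have hn' : (n : ℝ) ≠ 0 := by positivity
  have hEn : E n ≠ 0 := (Real.exp_pos _).ne'
  simp only [Pi.div_apply]
  field_simp
end
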